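/- Every outer 1-planar graph on n ≥ 3 vertices has at most 2.5n − 4 edges, and this bound is tight for infinitely many n. -/

import Mathlib

open Set

noncomputable section

/-- The Euclidean plane, where graphs are drawn. -/
abbrev Plane : Type := ℝ × ℝ

/-- A drawing of a multigraph on vertex type `V` with edges indexed by `E`,
`ends e` being the (unordered) pair of endpoints of `e`.  Vertices are distinct
points, edges are simple Jordan arcs joining their endpoints, arcs avoid vertices
in their interior, and edges sharing an endpoint do not cross. -/
structure MultiDrawing (V E : Type) (ends : E → Sym2 V) where
  pos : V → Plane
  pos_inj : Function.Injective pos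
  arc : E → ℝ → Plane
  arc_cont : ∀ e, ContinuousOn (arc e) (Icc (0:ℝ) 1)
  arc_inj : ∀ e, InjOn (arc e) (Icc (0:ℝ) 1)
  arc_ends : ∀ e, ∃ u v : V, ends e = s(u, v) ∧ arc e 0 = pos u ∧ arc e 1 = pos v
  arc_avoid : ∀ e, ∀ w : V, pos w ∉ arc e '' Ioo (0:ℝ) 1
  no_incident_cross : ∀ e f, e ≠ f →
    (arc e '' Ioo (0:ℝ) 1 ∩ arc f '' Ioo (0:ℝ) 1).Nonempty →
    ∀ x : V, ¬(x ∈ ends e ∧ x ∈ ends f)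

namespace MultiDrawing

variable {V E : Type} {ends : E → Sym2 V}

/-- The interior (open part) of the arc of edge `e`. -/
def inter (D : MultiDrawing V E ends) (e : E) : Set Plane := D.arc e '' Ioo (0:ℝ) 1

/-- The crossings of edge `e`: pairs of another edge and a common interior point. -/
def crossSet (D : MultiDrawing V E ends) (e : E) : Set (E × Plane) :=
  {fp | fp.1 ≠ e ∧ fp.2 ∈ D.inter e ∩ D.inter fp.1}

/-- A planar drawing: no edge is crossed. -/
def IsPlanarD (D : MultiDrawing V E ends) : Prop := ∀ e, D.crossSet e = ∅

/-- A 1-planar drawing: each edge is crossed at most once. -/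
def IsOnePlanarD (D : MultiDrawing V E ends) : Prop := ∀ e, (D.crossSet e).Subsingleton

/-- The point set occupied by the drawing. -/
def image (D : MultiDrawing V E ends) : Set Plane :=
  range D.pos ∪ ⋃ e, D.arc e '' Icc (0:ℝ) 1

/-- A face of a drawing: a connected component of the complement of its image. -/
def IsFace (D : MultiDrawing V E ends) (F : Set Plane) : Prop :=
  ∃ p, p ∉ D.image ∧ F = connectedComponentIn D.imageᶜ p

/-- A triangulated drawing: the boundary of each face meets (segments of) exactly
three edges. -/
def IsTriangulated (D : MultiDrawing V E ends) : Prop :=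
  ∀ F : Set Plane, D.IsFace F →
    {e : E | (frontier F ∩ D.arc e '' Icc (0:ℝ) 1).Nonempty}.ncard = 3

end MultiDrawing

/-- A drawing of a simple graph: arcs indexed by its edge set. -/
abbrev SimpleGraph.Drawing {V : Type} (G : SimpleGraph V) : Type :=
  MultiDrawing V ↥G.edgeSet (fun e => (e : Sym2 V))

/-- A graph is 1-planar if it has a drawing with at most one crossing per edge. -/
def SimpleGraph.IsOnePlanar {V : Type} (G : SimpleGraph V) : Prop :=
  ∃ D : G.Drawing, D.IsOnePlanarD

/-- A graph is planar if it has a crossing-free drawing. -/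
def SimpleGraph.IsPlanarGraph {V : Type} (G : SimpleGraph V) : Prop :=
  ∃ D : G.Drawing, D.IsPlanarD

/-- Points of the sphere. -/
abbrev SpherePt : Type := ↥(Metric.sphere (0 : EuclideanSpace ℝ (Fin 3)) 1)

/-- A subset of the sphere that is homeomorphic to a closed disk. -/
def IsClosedDisk (s : Set SpherePt) : Prop :=
  Nonempty (↥s ≃ₜ ↥(Metric.closedBall (0 : Plane) 1))

/-- A map: a partition of the sphere into closed-disk regions with pairwise
disjoint interiors, some of which are labeled as countries. -/
structure SphereMap (C : Type) where
  region : C → Set SpherePt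
  country : C → Prop
  disk : ∀ c, IsClosedDisk (region c)
  int_disjoint : ∀ c d : C, c ≠ d → interior (region c) ∩ interior (region d) = ∅
  cover : ⋃ c, region c = Set.univ

/-- A `k`-map: at most `k` regions meet at any point. -/
def SphereMap.IsKMap {C : Type} (M : SphereMap C) (k : ℕ) : Prop :=
  ∀ p : SpherePt, {c : C | p ∈ M.region c}.ncard ≤ k

/-- A hole-free map: every region is a country. -/
def SphereMap.HoleFree {C : Type} (M : SphereMap C) : Prop := ∀ c, M.country c

/-- `G` is the map graph of `M`: its vertices correspond to the countries of `M`,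
with edges given by touching countries. -/
def IsMapGraphOf {V C : Type} (G : SimpleGraph V) (M : SphereMap C) : Prop :=
  ∃ φ : V ≃ {c : C // M.country c},
    ∀ u v : V, G.Adj u v ↔ u ≠ v ∧ (M.region (φ u) ∩ M.region (φ v)).Nonempty

/-- `G` is a map graph. -/
def IsMapGraph {V : Type} (G : SimpleGraph V) : Prop :=
  ∃ (C : Type) (_ : Finite C) (M : SphereMap C), IsMapGraphOf G M

/-- `G` is a `k`-map graph. -/
def IsKMapGraph {V : Type} (G : SimpleGraph V) (k : ℕ) : Prop :=
  ∃ (C : Type) (_ : Finite C) (M : SphereMap C), M.IsKMap k ∧ IsMapGraphOf G M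

/-- `G` is a hole-free `k`-map graph. -/
def IsHoleFreeKMapGraph {V : Type} (G : SimpleGraph V) (k : ℕ) : Prop :=
  ∃ (C : Type) (_ : Finite C) (M : SphereMap C),
    M.HoleFree ∧ M.IsKMap k ∧ IsMapGraphOf G M
/-- An outer 1-planar graph: it has a 1-planar drawing with all vertices on the
outer (unbounded) face. -/
def OuterOnePlanar {V : Type} (G : SimpleGraph V) : Prop :=
  ∃ D : G.Drawing, D.IsOnePlanarD ∧
    ∃ F : Set Plane, D.IsFace F ∧ ¬Bornology.IsBounded F ∧ ∀ v : V, D.pos v ∈ closure F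

theorem exists_log_plane (f : ℝ × ℝ → ℂ) (hf : Continuous f) (h0 : ∀ a, f a ≠ 0) :
    ∃ L : ℝ × ℝ → ℂ, Continuous L ∧ ∀ a, Complex.exp (L a) = f a := by
  obtain ⟨F, ⟨-, hF⟩, -⟩ := Complex.isCoveringMapOn_exp.existsUnique_continuousMap_lifts
    (A := ℝ × ℝ) ⟨f, hf⟩ (a₀ := (0, 0)) (e₀ := Complex.log (f (0, 0)))
    (by simpa using Complex.exp_log (h0 _)) (by simpa using h0)
  exact ⟨F, F.continuous, fun a => congrFun hF a⟩

/-- Two continuous logarithms of the same function on the line differ by a constant. -/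
theorem log_change_eq (f g : ℝ → ℂ) (hf : Continuous f) (hg : Continuous g)
    (h : ∀ t, Complex.exp (f t) = Complex.exp (g t)) : f 1 - f 0 = g 1 - g 0 := by
  have key : ∀ t, ∃ n : ℤ, f t - g t = n * (2 * Real.pi * Complex.I) := by
    intro t
    obtain ⟨n, hn⟩ := Complex.exp_eq_exp_iff_exists_int.1 (h t)
    exact ⟨n, by rw [hn]; ring⟩
  choose n hn using key
  have hpi : (2 * Real.pi * Complex.I : ℂ) ≠ 0 := Complex.two_pi_I_ne_zero
  have hc : Continuous (fun t => (n t : ℂ)) := by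
    have : (fun t => (n t : ℂ)) = fun t => (f t - g t) / (2 * Real.pi * Complex.I) := by
      funext t; rw [hn t]; field_simp
    rw [this]; fun_prop
  have hc' : Continuous n := by
    have hc2 : Continuous (fun t => (n t : ℝ)) := by
      have := Complex.continuous_re.comp hc
      simpa [Function.comp_def] using this
    exact (Int.isClosedEmbedding_coe_real.isInducing).continuous_iff.2 hc2
  have : n 1 = n 0 := PreconnectedSpace.constant inferInstance hc'
  have h1 := hn 1
  have h2 := hn 0
  rw [this, ← h2] at h1
  linear_combination h1

theorem log_change_eq_neg (f g : ℝ → ℂ) (hf : Continuous f) (hg : Continuous g)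
    (h : ∀ t, Complex.exp (f t) = - Complex.exp (g t)) : f 1 - f 0 = g 1 - g 0 := by
  have := log_change_eq f (fun t => g t + Real.pi * Complex.I) hf (by fun_prop) (by
    intro t; rw [h t, Complex.exp_add, Complex.exp_pi_mul_I]; ring)
  rw [this]; ring

/-- the integer system behind the non-planarity of `K_{3,3}` has no solution -/
theorem int_system_false (c d : Fin 3 → Fin 3 → Fin 3 → ℤ) 
   (h : ∀ i i' j j' : Fin 3, i < i' → j ≠ j' → (if j < j' then 1 else 0) 
      + (c i j i' + d i' j' j - c i' j' i - d i j j') = 0) : False := by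
  have a1 := h 0 1 0 1 (by decide) (by decide)
  have a2 := h 0 1 0 2 (by decide) (by decide)
  have a3 := h 0 1 1 2 (by decide) (by decide)
  have a4 := h 0 1 1 0 (by decide) (by decide)
  have a5 := h 0 1 2 0 (by decide) (by decide)
  have a6 := h 0 1 2 1 (by decide) (by decide)
  have b1 := h 0 2 0 1 (by decide) (by decide)
  have b2 := h 0 2 0 2 (by decide) (by decide)
  have b3 := h 0 2 1 2 (by decide) (by decide)
  have b4 := h 0 2 1 0 (by decide) (by decide)
  have b5 := h 0 2 2 0 (by decide) (by decide)
  have b6 := h 0 2 2 1 (by decide) (by decide)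
  have c1 := h 1 2 0 1 (by decide) (by decide)
  have c2 := h 1 2 0 2 (by decide) (by decide)
  have c3 := h 1 2 1 2 (by decide) (by decide)
  have c4 := h 1 2 1 0 (by decide) (by decide)
  have c5 := h 1 2 2 0 (by decide) (by decide)
  have c6 := h 1 2 2 1 (by decide) (by decide)
  simp at *
  omega

theorem exists_other (j : Fin 3) : ∃ j' : Fin 3, j ≠ j' := by
  revert j; decide

theorem exists_log_change (f : ℝ → ℂ) (hf : Continuous f) (h0 : ∀ t, f t ≠ 0) :
    ∃ D : ℂ, Complex.exp D * f 0 = f 1 ∧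
      (∀ g : ℝ → ℂ, Continuous g → (∀ t, Complex.exp (g t) = f t) → g 1 - g 0 = D) ∧
      (∀ g : ℝ → ℂ, Continuous g → (∀ t, Complex.exp (g t) = - f t) → g 1 - g 0 = D) := by
  obtain ⟨L, hL, hLe⟩ := exists_log_plane (fun a => f a.1) (by fun_prop) (fun a => h0 _)
  have hL' : Continuous fun t : ℝ => L (t, 0) := by fun_prop
  refine ⟨L (1, 0) - L (0, 0), ?_, ?_, ?_⟩
  · rw [← hLe (0, 0), ← hLe (1, 0), ← Complex.exp_add]; simp
  · intro g hg h
    exact log_change_eq g (fun t => L (t, 0)) hg hL' (fun t => by rw [h, hLe])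
  · intro g hg h
    exact log_change_eq_neg g (fun t => L (t, 0)) hg hL' (fun t => by rw [h, hLe])

/-- A strong form of the non-planarity of `K_{3,3}`: in any continuous drawing, two
independent edges meet. -/
theorem k33_independent_meet (x y : Fin 3 → ℂ) (g : Fin 3 → Fin 3 → ℝ → ℂ)
    (hg : ∀ i j, Continuous (g i j)) (g0 : ∀ i j, g i j 0 = x i) (g1 : ∀ i j, g i j 1 = y j)
    (hd : ∀ i i' j j', i ≠ i' → j ≠ j' → ∀ s t, g i j s ≠ g i' j' t) : False := by
  have hx : ∀ i i' j, i ≠ i' → ∀ t, g i j t - x i' ≠ 0 := by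
    intro i i' j h t
    obtain ⟨j', hj⟩ := exists_other j
    rw [← g0 i' j', sub_ne_zero]
    exact hd _ _ _ _ h hj _ _
  have hy : ∀ i j j', j ≠ j' → ∀ t, g i j t - y j' ≠ 0 := by
    intro i j j' h t
    obtain ⟨i', hj⟩ := exists_other i
    rw [← g1 i' j', sub_ne_zero]
    exact hd _ _ _ _ hj h _ _
  have hxx : ∀ i i', i ≠ i' → x i - x i' ≠ 0 := by
    intro i i' h; have := hx i i' 0 h 0; rwa [g0] at this
  have hyy : ∀ i i', i ≠ i' → y i - y i' ≠ 0 := by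
    intro i i' h; have := hy 0 i i' h 1; rwa [g1] at this
  have hyx : ∀ i j, y j - x i ≠ 0 := by
    intro i j
    obtain ⟨i', hi⟩ := exists_other i
    have := hx i' i j hi.symm 1; rwa [g1] at this
  have hC : ∀ i j i', ∃ D : ℂ, i ≠ i' → (Complex.exp D * (x i - x i') = y j - x i' ∧
      (∀ f : ℝ → ℂ, Continuous f → (∀ t, Complex.exp (f t) = g i j t - x i') → f 1 - f 0 = D) ∧
      (∀ f : ℝ → ℂ, Continuous f → (∀ t, Complex.exp (f t) = - (g i j t - x i')) →
        f 1 - f 0 = D)) := by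
    intro i j i'
    by_cases h : i = i'
    · exact ⟨0, fun h' => absurd h h'⟩
    · obtain ⟨D, hD⟩ := exists_log_change (fun t => g i j t - x i') (by have := hg i j; fun_prop)
        (hx i i' j h)
      refine ⟨D, fun _ => ?_⟩
      simpa only [g0, g1] using hD
  have hE : ∀ i j j', ∃ D : ℂ, j ≠ j' → (Complex.exp D * (x i - y j') = y j - y j' ∧
      (∀ f : ℝ → ℂ, Continuous f → (∀ t, Complex.exp (f t) = g i j t - y j') → f 1 - f 0 = D) ∧
      (∀ f : ℝ → ℂ, Continuous f → (∀ t, Complex.exp (f t) = - (g i j t - y j')) →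
        f 1 - f 0 = D)) := by
    intro i j i'
    by_cases h : j = i'
    · exact ⟨0, fun h' => absurd h h'⟩
    · obtain ⟨D, hD⟩ := exists_log_change (fun t => g i j t - y i') (by have := hg i j; fun_prop)
        (hy i j i' h)
      refine ⟨D, fun _ => ?_⟩
      simpa only [g0, g1] using hD
  choose C hC using hC
  choose E hE using hE
  -- the square identity
  have sq : ∀ i i' j j', i ≠ i' → j ≠ j' → C i j i' + E i' j' j = C i' j' i + E i j j' := by
    intro i i' j j' hi hj
    obtain ⟨L, hL, hLe⟩ := exists_log_plane (fun a => g i j a.1 - g i' j' a.2)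
      (by have := hg i j; have := hg i' j'; fun_prop)
      (fun a => sub_ne_zero.2 (hd _ _ _ _ hi hj _ _))
    have e1 := (hC i j i' hi).2.1 (fun s => L (s, 0)) (by fun_prop) (fun t => by
      rw [hLe, g0])
    have e2 := (hE i j j' hj).2.1 (fun s => L (s, 1)) (by fun_prop) (fun t => by
      rw [hLe, g1])
    have e3 := (hC i' j' i hi.symm).2.2 (fun s => L (0, s)) (by fun_prop) (fun t => by
      rw [hLe, g0]; ring)
    have e4 := (hE i' j' j hj.symm).2.2 (fun s => L (1, s)) (by fun_prop) (fun t => by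
      rw [hLe, g1]; ring)
    rw [← e1, ← e2, ← e3, ← e4]; ring
  -- choose logarithms
  let P : Fin 3 → Fin 3 → ℂ := fun i j => Complex.log (y j - x i)
  have hP : ∀ i j, Complex.exp (P i j) = y j - x i := fun i j => Complex.exp_log (hyx i j)
  let A : Fin 3 → Fin 3 → ℂ := fun i i' => if i < i' then Complex.log (x i - x i') else
    Complex.log (x i' - x i) + Real.pi * Complex.I
  have hA : ∀ i i', i ≠ i' → Complex.exp (A i i') = x i - x i' := by
    intro i i' h
    by_cases h' : i < i'
    · simp only [A, h', if_true]; exact Complex.exp_log (hxx _ _ h)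
    · simp only [A, h', if_false]
      rw [Complex.exp_add, Complex.exp_log (hxx _ _ h.symm), Complex.exp_pi_mul_I]; ring
  let B : Fin 3 → Fin 3 → ℂ := fun i i' => if i < i' then Complex.log (y i - y i') else
    Complex.log (y i' - y i) + Real.pi * Complex.I
  have hB : ∀ i i', i ≠ i' → Complex.exp (B i i') = y i - y i' := by
    intro i i' h
    by_cases h' : i < i'
    · simp only [B, h', if_true]; exact Complex.exp_log (hyy _ _ h)
    · simp only [B, h', if_false]
      rw [Complex.exp_add, Complex.exp_log (hyy _ _ h.symm), Complex.exp_pi_mul_I]; ring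
  have hc : ∀ i j i', ∃ c : ℤ, i ≠ i' →
      C i j i' = P i' j - A i i' + c * (2 * Real.pi * Complex.I) := by
    intro i j i'
    by_cases h : i = i'
    · exact ⟨0, fun h' => absurd h h'⟩
    have : Complex.exp (C i j i') = Complex.exp (P i' j - A i i') := by
      rw [Complex.exp_sub, hP, hA _ _ h, eq_div_iff (hxx _ _ h)]
      exact (hC i j i' h).1
    obtain ⟨n, hn⟩ := Complex.exp_eq_exp_iff_exists_int.1 this
    exact ⟨n, fun _ => hn⟩
  have he : ∀ i j j', ∃ c : ℤ, j ≠ j' →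
      E i j j' = B j j' - P i j' - Real.pi * Complex.I + c * (2 * Real.pi * Complex.I) := by
    intro i j j'
    by_cases h : j = j'
    · exact ⟨0, fun h' => absurd h h'⟩
    have : Complex.exp (E i j j') = Complex.exp (B j j' - P i j' - Real.pi * Complex.I) := by
      rw [Complex.exp_sub, Complex.exp_sub, hP, hB _ _ h, Complex.exp_pi_mul_I]
      have := (hE i j j' h).1
      have h3 := hyx i j'
      rw [div_neg, div_one, ← neg_div, eq_div_iff h3, ← this]; ring
    obtain ⟨n, hn⟩ := Complex.exp_eq_exp_iff_exists_int.1 this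
    exact ⟨n, fun _ => hn⟩
  choose c hc using hc
  choose e he using he
  apply int_system_false c e
  intro i i' j j' hi hj
  have h1 := sq i i' j j' hi.ne hj
  rw [hc i j i' hi.ne, hc i' j' i hi.ne', he i' j' j hj.symm, he i j j' hj] at h1
  have hAA : A i' i = A i i' + Real.pi * Complex.I := by
    simp [A, hi, hi.not_gt]
  have hpi : (2 * Real.pi * Complex.I : ℂ) ≠ 0 := Complex.two_pi_I_ne_zero
  rw [hAA] at h1
  by_cases hjj : j < j'
  · have hBB : B j' j = B j j' + Real.pi * Complex.I := by
      simp [B, hjj, hjj.not_gt]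
    rw [hBB] at h1
    have h2 : ((1 + (c i j i' + e i' j' j - c i' j' i - e i j j') : ℤ) : ℂ) *
        (2 * Real.pi * Complex.I) = 0 := by
      push_cast; linear_combination h1
    have h3 := (mul_eq_zero.1 h2).resolve_right hpi
    simp only [hjj, if_true]
    exact_mod_cast h3
  · have hjj' : j' < j := lt_of_le_of_ne (not_lt.1 hjj) hj.symm
    have hBB : B j j' = B j' j + Real.pi * Complex.I := by
      simp [B, hjj', hjj]
    rw [hBB] at h1
    have h2 : (((c i j i' + e i' j' j - c i' j' i - e i j j') : ℤ) : ℂ) *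
        (2 * Real.pi * Complex.I) = 0 := by
      push_cast; linear_combination h1
    have h3 := (mul_eq_zero.1 h2).resolve_right hpi
    simp only [hjj, if_false, zero_add]
    exact_mod_cast h3

/-- `K_{3,3}` in the plane, with edges given by `JoinedIn`. -/
theorem k33_joinedIn (x y : Fin 3 → ℝ × ℝ) (S : Fin 3 → Fin 3 → Set (ℝ × ℝ))
    (hS : ∀ i j, JoinedIn (S i j) (x i) (y j))
    (hd : ∀ i i' j j', i ≠ i' → j ≠ j' → Disjoint (S i j) (S i' j')) : False := by
  let φ : (ℝ × ℝ) ≃L[ℝ] ℂ := Complex.equivRealProdCLM.symm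
  refine k33_independent_meet (fun i => φ (x i)) (fun j => φ (y j))
    (fun i j t => φ ((hS i j).somePath.extend t)) ?_ ?_ ?_ ?_
  · intro i j
    exact φ.continuous.comp (hS i j).somePath.continuous_extend
  · intro i j; simp
  · intro i j; simp
  · intro i i' j j' hi hj s t h
    have h' := φ.injective h
    refine (Set.disjoint_left.1 (hd i i' j j' hi hj) : ∀ ⦃a⦄, a ∈ _ → a ∉ _) (a := (hS i j).somePath.extend s) ?_ ?_
    · exact (hS i j).somePath_mem _
    · rw [h']; exact (hS i' j').somePath_mem _

namespace MultiDrawing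
variable {V E : Type} {ends : E → Sym2 V}

theorem isClosed_image [Finite V] [Finite E] (D : MultiDrawing V E ends) : IsClosed D.image := by
  refine IsClosed.union (Set.finite_range _).isClosed ?_
  exact isClosed_iUnion_of_finite fun e =>
    (isCompact_Icc.image_of_continuousOn (D.arc_cont e)).isClosed

/-- The key topological fact: an outer drawing contains no (weak) `K_{2,3}`. -/
theorem no_k23 [Finite V] [Finite E] (D : MultiDrawing V E ends)
    {F : Set Plane} (hF : D.IsFace F) (hcl : ∀ v : V, D.pos v ∈ closure F)
    (x y : Plane) (a : Fin 3 → V) (S T : Fin 3 → Set Plane)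
    (hSi : ∀ j, S j ⊆ D.image) (hTi : ∀ j, T j ⊆ D.image)
    (hS : ∀ j, JoinedIn (S j) x (D.pos (a j))) (hT : ∀ j, JoinedIn (T j) y (D.pos (a j)))
    (hd : ∀ j k, j ≠ k → Disjoint (S j) (T k)) : False := by
  obtain ⟨q, hq, rfl⟩ := hF
  set F := connectedComponentIn D.imageᶜ q with hFdef
  have hopen : IsOpen F := D.isClosed_image.isOpen_compl.connectedComponentIn
  have hqF : q ∈ F := mem_connectedComponentIn hq
  have hconn : IsConnected F := isConnected_connectedComponentIn_iff.2 hq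
  have hpath : IsPathConnected F := hopen.isConnected_iff_isPathConnected.1 hconn
  have hsub : F ⊆ D.imageᶜ := connectedComponentIn_subset _ _
  -- replace the sets by compact ones
  let S' : Fin 3 → Set Plane := fun j => range (hS j).somePath
  let T' : Fin 3 → Set Plane := fun j => range (hT j).somePath
  have hSS : ∀ j, S' j ⊆ S j := fun j => by
    rintro _ ⟨t, rfl⟩; exact (hS j).somePath_mem t
  have hTT : ∀ j, T' j ⊆ T j := fun j => by
    rintro _ ⟨t, rfl⟩; exact (hT j).somePath_mem t
  have hSc : ∀ j, IsClosed (S' j) := fun j => (isCompact_range (hS j).somePath.continuous).isClosed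
  have hTc : ∀ j, IsClosed (T' j) := fun j => (isCompact_range (hT j).somePath.continuous).isClosed
  have hS' : ∀ j, JoinedIn (S' j) x (D.pos (a j)) := fun j =>
    ⟨(hS j).somePath, fun t => mem_range_self t⟩
  have hT' : ∀ j, JoinedIn (T' j) y (D.pos (a j)) := fun j =>
    ⟨(hT j).somePath, fun t => mem_range_self t⟩
  have hball : ∀ j, ∃ ε > 0, ∀ k, j ≠ k →
      Disjoint (Metric.ball (D.pos (a j)) ε) (S' k ∪ T' k) := by
    intro j
    have hc : IsClosed (⋃ k : {k // j ≠ k}, (S' k ∪ T' k)) :=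
      isClosed_iUnion_of_finite fun k => (hSc _).union (hTc _)
    have hn : D.pos (a j) ∈ (⋃ k : {k // j ≠ k}, (S' k ∪ T' k))ᶜ := by
      simp only [mem_compl_iff, mem_iUnion, not_exists, Subtype.forall]
      rintro k hk (h | h)
      · exact disjoint_left.1 (hd k j hk.symm) (hSS _ h) ((hT j).target_mem)
      · exact disjoint_left.1 (hd j k hk) ((hS j).target_mem) (hTT _ h)
    obtain ⟨ε, hε, h⟩ := Metric.isOpen_iff.1 hc.isOpen_compl _ hn
    refine ⟨ε, hε, fun k hk => disjoint_left.2 fun p hp hp' => h hp ?_⟩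
    exact mem_iUnion.2 ⟨⟨k, hk⟩, hp'⟩
  choose ε hε hb using hball
  have hQ : ∀ j, JoinedIn (F ∪ Metric.ball (D.pos (a j)) (ε j)) q (D.pos (a j)) := by
    intro j
    obtain ⟨r, hrb, hrF⟩ := mem_closure_iff.1 (hcl (a j)) _ Metric.isOpen_ball
      (Metric.mem_ball_self (hε j))
    have h1 : JoinedIn F q r := hpath.joinedIn _ hqF _ hrF
    have h2 : JoinedIn (Metric.ball (D.pos (a j)) (ε j)) r (D.pos (a j)) :=
      ((convex_ball _ _).isPathConnected ⟨_, hrb⟩).joinedIn _ hrb _ (Metric.mem_ball_self (hε j))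
    exact (h1.mono subset_union_left).trans (h2.mono subset_union_right)
  have hdQS : ∀ j k, j ≠ k → Disjoint (F ∪ Metric.ball (D.pos (a j)) (ε j)) (S' k) := by
    intro j k hjk
    refine disjoint_left.2 ?_
    rintro p (hp | hp) hp'
    · exact hsub hp (hSi _ (hSS _ hp'))
    · exact disjoint_left.1 (hb j k hjk) hp (Or.inl hp')
  have hdQT : ∀ j k, j ≠ k → Disjoint (F ∪ Metric.ball (D.pos (a j)) (ε j)) (T' k) := by
    intro j k hjk
    refine disjoint_left.2 ?_
    rintro p (hp | hp) hp'
    · exact hsub hp (hTi _ (hTT _ hp'))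
    · exact disjoint_left.1 (hb j k hjk) hp (Or.inr hp')
  have hST : ∀ j k, j ≠ k → Disjoint (S' j) (T' k) := fun j k h =>
    (hd j k h).mono (hSS _) (hTT _)
  refine k33_joinedIn ![x, y, q] (fun j => D.pos (a j))
    ![S', T', fun j => F ∪ Metric.ball (D.pos (a j)) (ε j)] ?_ ?_
  · intro i j
    fin_cases i
    · exact hS' j
    · exact hT' j
    · exact hQ j
  · intro i i' j j' hi hj
    fin_cases i <;> fin_cases i' <;> first | exact absurd rfl hi | skip
    · exact hST _ _ hj
    · exact (hdQS _ _ hj.symm).symm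
    · exact (hST _ _ hj.symm).symm
    · exact (hdQT _ _ hj.symm).symm
    · exact hdQS _ _ hj
    · exact hdQT _ _ hj

end MultiDrawing

namespace MultiDrawing
variable {V E : Type} {ends : E → Sym2 V}

theorem inter_joined (D : MultiDrawing V E ends) (e : E) {p q : Plane} (hp : p ∈ D.inter e)
    (hq : q ∈ D.inter e) : JoinedIn (D.inter e) p q := by
  have h : IsPathConnected (D.inter e) := by
    refine ((convex_Ioo (0:ℝ) 1).isPathConnected ⟨1/2, by norm_num, by norm_num⟩).image' ?_
    exact (D.arc_cont e).mono Ioo_subset_Icc_self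
  exact h.joinedIn _ hp _ hq

theorem end_joined (D : MultiDrawing V E ends) (e : E) {u : V} (hu : u ∈ ends e) {p : Plane}
    (hp : p ∈ D.inter e) : JoinedIn (D.inter e ∪ {D.pos u}) p (D.pos u) := by
  obtain ⟨a, b, hab, h0, h1⟩ := D.arc_ends e
  rw [hab, Sym2.mem_iff] at hu
  rcases hu with rfl | rfl
  · have h : IsPathConnected (D.arc e '' Ico 0 1) := by
      refine ((convex_Ico (0:ℝ) 1).isPathConnected ⟨1/2, by norm_num, by norm_num⟩).image' ?_
      exact (D.arc_cont e).mono Ico_subset_Icc_self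
    have h2 : D.arc e '' Ico 0 1 ⊆ D.inter e ∪ {D.pos u} := by
      rintro _ ⟨t, ht, rfl⟩
      rcases ht.1.eq_or_lt with h | h
      · right; rw [← h, h0]; rfl
      · left; exact ⟨t, ⟨h, ht.2⟩, rfl⟩
    refine (h.joinedIn _ ?_ _ ?_).mono h2
    · exact image_mono Ioo_subset_Ico_self hp
    · exact ⟨0, by norm_num, h0⟩
  · have h : IsPathConnected (D.arc e '' Ioc 0 1) := by
      refine ((convex_Ioc (0:ℝ) 1).isPathConnected ⟨1/2, by norm_num, by norm_num⟩).image' ?_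
      exact (D.arc_cont e).mono Ioc_subset_Icc_self
    have h2 : D.arc e '' Ioc 0 1 ⊆ D.inter e ∪ {D.pos u} := by
      rintro _ ⟨t, ht, rfl⟩
      rcases ht.2.eq_or_lt with h | h
      · right; rw [h, h1]; rfl
      · left; exact ⟨t, ⟨ht.1, h⟩, rfl⟩
    refine (h.joinedIn _ ?_ _ ?_).mono h2
    · exact image_mono Ioo_subset_Ioc_self hp
    · exact ⟨1, by norm_num, h1⟩

theorem inter_subset_image (D : MultiDrawing V E ends) (e : E) : D.inter e ⊆ D.image := by
  intro p hp
  exact Or.inr (mem_iUnion.2 ⟨e, image_mono Ioo_subset_Icc_self hp⟩)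

theorem pos_mem_image (D : MultiDrawing V E ends) (v : V) : D.pos v ∈ D.image :=
  Or.inl ⟨v, rfl⟩

/-- midpoint of an arc -/
def mid (D : MultiDrawing V E ends) (e : E) : Plane := D.arc e (1/2)

theorem mid_mem (D : MultiDrawing V E ends) (e : E) : D.mid e ∈ D.inter e :=
  ⟨1/2, by norm_num, rfl⟩

end MultiDrawing

open Classical in
/-- the edges with both ends in `S` -/
def edgesIn {V E : Type} [Fintype E] (ends : E → Sym2 V) (S : Finset V) : Finset E :=
  Finset.univ.filter fun e => ∀ u ∈ ends e, u ∈ S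

theorem mem_edgesIn {V E : Type} [Fintype E] {ends : E → Sym2 V} {S : Finset V} {e : E} :
    e ∈ edgesIn ends S ↔ ∀ u ∈ ends e, u ∈ S := by
  simp [edgesIn]

namespace MultiDrawing
variable {V E : Type} {ends : E → Sym2 V} [Fintype E]

/-- The part of the drawing spanned by `S` that remains after removing the edges in `R` and
the vertices in `A`. -/
def rest (D : MultiDrawing V E ends) (S A : Finset V) (R : Finset E) : Set Plane :=
  {p | (∃ e ∈ edgesIn ends S, e ∉ R ∧ p ∈ D.inter e) ∨ ∃ w ∈ S, w ∉ A ∧ p = D.pos w}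

open Classical in
/-- Attachments in `A` of the path component of `z`. -/
def att (D : MultiDrawing V E ends) (S A : Finset V) (R : Finset E) (z : Plane) : Finset V :=
  A.filter fun u => ∃ e ∈ edgesIn ends S, e ∉ R ∧ u ∈ ends e ∧
    JoinedIn (D.rest S A R) z (D.mid e)

variable (D : MultiDrawing V E ends) (S A : Finset V) (R : Finset E)

theorem mem_att {z : Plane} {u : V} : u ∈ D.att S A R z ↔ u ∈ A ∧ ∃ e ∈ edgesIn ends S, e ∉ R ∧
    u ∈ ends e ∧ JoinedIn (D.rest S A R) z (D.mid e) := by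
  simp [att]

theorem att_congr {z z' : Plane} (h : JoinedIn (D.rest S A R) z z') :
    D.att S A R z = D.att S A R z' := by
  ext u
  simp only [mem_att]
  constructor
  · rintro ⟨h1, e, h2, h3, h4, h5⟩; exact ⟨h1, e, h2, h3, h4, h.symm.trans h5⟩
  · rintro ⟨h1, e, h2, h3, h4, h5⟩; exact ⟨h1, e, h2, h3, h4, h.trans h5⟩

theorem rest_subset_image : D.rest S A R ⊆ D.image := by
  rintro p (⟨e, -, -, h⟩ | ⟨w, -, -, rfl⟩)
  · exact D.inter_subset_image e h
  · exact D.pos_mem_image w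

theorem pos_not_mem_rest {u : V} (hu : u ∈ A) : D.pos u ∉ D.rest S A R := by
  rintro (⟨e, -, -, h⟩ | ⟨w, -, hw, h⟩)
  · exact D.arc_avoid e u h
  · exact hw (D.pos_inj h ▸ hu)

theorem inter_subset_rest {e : E} (he : e ∈ edgesIn ends S) (hR : e ∉ R) :
    D.inter e ⊆ D.rest S A R := fun _ hp => Or.inl ⟨e, he, hR, hp⟩

/-- the bridge (path component) of `z` -/
def bridge (z : Plane) : Set Plane := pathComponentIn (D.rest S A R) z

theorem bridge_subset (z : Plane) : D.bridge S A R z ⊆ D.rest S A R := pathComponentIn_subset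

theorem att_joined {z : Plane} {u : V} (hu : u ∈ D.att S A R z)
    {z' : Plane} (hz' : z' ∈ D.bridge S A R z) :
    JoinedIn (D.bridge S A R z ∪ {D.pos u}) z' (D.pos u) := by
  obtain ⟨h1, e, h2, h3, h4, h5⟩ := (D.mem_att S A R).1 hu
  have hm : D.mid e ∈ D.bridge S A R z := h5
  have hz : z ∈ D.rest S A R := h5.source_mem
  have hpc : IsPathConnected (D.bridge S A R z) := isPathConnected_pathComponentIn hz
  have hsub : D.inter e ⊆ D.bridge S A R z := fun p hp =>
    h5.trans ((D.inter_joined e (D.mid_mem e) hp).mono (D.inter_subset_rest S A R h2 h3))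
  refine ((hpc.joinedIn _ hz' _ hm).mono subset_union_left).trans ?_
  exact (D.end_joined e h4 (D.mid_mem e)).mono (union_subset_union_left _ hsub)

theorem self_mem_bridge {z : Plane} (hz : z ∈ D.rest S A R) : z ∈ D.bridge S A R z :=
  JoinedIn.refl hz

theorem bridge_disjoint {z z' : Plane} (h : D.att S A R z ≠ D.att S A R z') :
    Disjoint (D.bridge S A R z) (D.bridge S A R z') := by
  refine disjoint_left.2 fun p hp hp' => h ?_
  rw [D.att_congr S A R hp, D.att_congr S A R hp']

/-- An attachment either comes with a vertex in the bridge, or with an edge inside `A`. -/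
theorem att_edge (hnd : ∀ e, ¬ (ends e).IsDiag) {z : Plane} {u : V} (hu : u ∈ D.att S A R z) :
    (∃ s ∈ S, s ∉ A ∧ D.pos s ∈ D.bridge S A R z) ∨
    ∃ e ∈ edgesIn ends S, e ∉ R ∧ ∃ u', ends e = s(u, u') ∧ u' ≠ u ∧ u' ∈ D.att S A R z := by
  obtain ⟨h1, e, h2, h3, h4, h5⟩ := (D.mem_att S A R).1 hu
  obtain ⟨u', hu'⟩ := Sym2.mem_iff_exists.1 h4
  have hmem : u' ∈ ends e := by rw [hu']; simp
  by_cases hA : u' ∈ A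
  · right
    refine ⟨e, h2, h3, u', hu', ?_, ?_⟩
    · rintro rfl; exact hnd e (by rw [hu']; simp)
    · exact (D.mem_att S A R).2 ⟨hA, e, h2, h3, hmem, h5⟩
  · left
    have hS : u' ∈ S := mem_edgesIn.1 h2 u' hmem
    refine ⟨u', hS, hA, ?_⟩
    refine h5.trans ((D.end_joined e hmem (D.mid_mem e)).mono ?_)
    refine union_subset (D.inter_subset_rest S A R h2 h3) ?_
    rintro _ rfl
    exact Or.inr ⟨u', hS, hA, rfl⟩

open Classical in
/-- Splitting the vertex set along the bridges. -/
theorem exists_partition (hAS : A ⊆ S) {k : ℕ} (Ai : Fin (k + 1) → Finset V)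
    (hAi : ∀ i, Ai i ⊆ A)
    (h : ∀ z ∈ D.rest S A R, ∃ i, D.att S A R z ⊆ Ai i) :
    ∃ W : Fin (k + 1) → Finset V, (∀ i, Ai i ⊆ W i) ∧
      (∀ i, (W i).card + A.card ≤ (Ai i).card + S.card) ∧
      (∑ i, (W i).card + A.card = S.card + ∑ i, (Ai i).card) ∧
      ∀ e ∈ edgesIn ends S, e ∉ R → ∃ i, e ∈ edgesIn ends (W i) := by
  have hg : ∀ T : Finset V, ∃ i : Fin (k + 1), (∃ i, T ⊆ Ai i) → T ⊆ Ai i := by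
    intro T
    by_cases hT : ∃ i, T ⊆ Ai i
    · obtain ⟨i, hi⟩ := hT; exact ⟨i, fun _ => hi⟩
    · exact ⟨0, fun h => absurd h hT⟩
  choose g hg using hg
  have hcard : (S \ A).card + A.card = S.card := Finset.card_sdiff_add_card_eq_card hAS
  have hdis : ∀ i, Disjoint (Ai i)
      ((S \ A).filter fun w => g (D.att S A R (D.pos w)) = i) := by
    intro i
    refine Finset.disjoint_left.2 fun u hu hu' => ?_
    exact (Finset.mem_sdiff.1 (Finset.mem_filter.1 hu').1).2 (hAi i hu)
  refine ⟨fun i => Ai i ∪ (S \ A).filter fun w => g (D.att S A R (D.pos w)) = i,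
    fun i => Finset.subset_union_left, ?_, ?_, ?_⟩
  · intro i
    rw [Finset.card_union_of_disjoint (hdis i)]
    have := Finset.card_filter_le (S \ A) fun w => g (D.att S A R (D.pos w)) = i
    omega
  · have : ∑ i, (Ai i ∪ (S \ A).filter fun w => g (D.att S A R (D.pos w)) = i).card =
        ∑ i, (Ai i).card + (S \ A).card := by
      rw [Finset.card_eq_sum_card_fiberwise (s := S \ A) (t := Finset.univ)
        (f := fun w => g (D.att S A R (D.pos w))) (by simp [Set.MapsTo]), ← Finset.sum_add_distrib]
      exact Finset.sum_congr rfl fun i _ => Finset.card_union_of_disjoint (hdis i)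
    rw [this]; omega
  · intro e he hR
    have hm : D.mid e ∈ D.rest S A R := D.inter_subset_rest S A R he hR (D.mid_mem e)
    refine ⟨g (D.att S A R (D.mid e)), mem_edgesIn.2 fun u hu => ?_⟩
    have huS := mem_edgesIn.1 he u hu
    by_cases huA : u ∈ A
    · refine Finset.mem_union_left _ (hg _ (h _ hm) ?_)
      exact (D.mem_att S A R).2 ⟨huA, e, he, hR, hu, JoinedIn.refl hm⟩
    · refine Finset.mem_union_right _ (Finset.mem_filter.2 ⟨Finset.mem_sdiff.2 ⟨huS, huA⟩, ?_⟩)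
      congr 1
      refine (D.att_congr S A R ?_).symm
      refine (D.end_joined e hu (D.mid_mem e)).mono ?_
      refine union_subset (D.inter_subset_rest S A R he hR) ?_
      rintro _ rfl
      exact Or.inr ⟨u, huS, huA, rfl⟩

end MultiDrawing

namespace MultiDrawing
variable {V E : Type} {ends : E → Sym2 V} [Fintype E] [Finite V]
variable (D : MultiDrawing V E ends) (S A : Finset V) (R : Finset E)

/-- No bridge attaches to three vertices joined to a common hub. -/
theorem hub_no_triple {F : Set Plane} (hF : D.IsFace F) (hcl : ∀ v : V, D.pos v ∈ closure F)
    (I : Set Plane) (hI : I ⊆ D.image) (hIr : Disjoint I (D.rest S A R)) (p : Plane)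
    (u : Fin 3 → V) (hu : Function.Injective u) (huI : ∀ j, D.pos (u j) ∉ I)
    (hpu : ∀ j, JoinedIn (I ∪ {D.pos (u j)}) p (D.pos (u j)))
    (z : Plane) (hz : z ∈ D.rest S A R) (hatt : ∀ j, u j ∈ D.att S A R z) : False := by
  have hA : ∀ j, D.pos (u j) ∉ D.rest S A R := fun j =>
    D.pos_not_mem_rest S A R ((D.mem_att S A R).1 (hatt j)).1
  have hB := D.bridge_subset S A R z
  refine D.no_k23 hF hcl p z u (fun j => I ∪ {D.pos (u j)})
    (fun j => D.bridge S A R z ∪ {D.pos (u j)}) ?_ ?_ hpu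
    (fun j => D.att_joined S A R (hatt j) (D.self_mem_bridge S A R hz)) ?_
  · intro j
    exact union_subset hI (by rintro _ rfl; exact D.pos_mem_image _)
  · intro j
    exact union_subset (hB.trans (D.rest_subset_image S A R))
      (by rintro _ rfl; exact D.pos_mem_image _)
  · intro j k hjk
    refine disjoint_left.2 ?_
    rintro q (hq | rfl) (hq' | hq')
    · exact disjoint_left.1 hIr hq (hB hq')
    · rw [mem_singleton_iff] at hq'; subst hq'; exact huI _ hq
    · exact hA _ (hB hq')
    · exact hjk (hu (D.pos_inj hq'))

/-- No vertex `w` is joined by bridges to three vertices joined to a common hub. -/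
theorem hub_no_star {F : Set Plane} (hF : D.IsFace F) (hcl : ∀ v : V, D.pos v ∈ closure F)
    (I : Set Plane) (hI : I ⊆ D.image) (hIr : Disjoint I (D.rest S A R)) (p : Plane)
    (u : Fin 3 → V) (hu : Function.Injective u) (huI : ∀ j, D.pos (u j) ∉ I)
    (hpu : ∀ j, JoinedIn (I ∪ {D.pos (u j)}) p (D.pos (u j)))
    (w : V) (hwI : D.pos w ∉ I) (hwu : ∀ j, u j ≠ w)
    (z : Fin 3 → Plane) (hz : ∀ j, z j ∈ D.rest S A R) (hatt : ∀ j, u j ∈ D.att S A R (z j))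
    (hattw : ∀ j, w ∈ D.att S A R (z j)) : False := by
  have hA : ∀ j, D.pos (u j) ∉ D.rest S A R := fun j =>
    D.pos_not_mem_rest S A R ((D.mem_att S A R).1 (hatt j)).1
  have hB := fun j => D.bridge_subset S A R (z j)
  refine D.no_k23 hF hcl p (D.pos w) u (fun j => I ∪ {D.pos (u j)})
    (fun j => D.bridge S A R (z j) ∪ {D.pos (u j), D.pos w}) ?_ ?_ hpu ?_ ?_
  · intro j
    exact union_subset hI (by rintro _ rfl; exact D.pos_mem_image _)
  · intro j
    exact union_subset ((hB j).trans (D.rest_subset_image S A R))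
      (by rintro _ (rfl | rfl) <;> exact D.pos_mem_image _)
  · intro j
    have h1 := D.att_joined S A R (hatt j) (D.self_mem_bridge S A R (hz j))
    have h2 := D.att_joined S A R (hattw j) (D.self_mem_bridge S A R (hz j))
    refine (h2.symm.mono ?_).trans (h1.mono ?_)
    · exact union_subset_union_right _ (by simp)
    · exact union_subset_union_right _ (by simp)
  · intro j k hjk
    refine disjoint_left.2 ?_
    rintro q (hq | rfl) (hq' | hq' | hq')
    · exact disjoint_left.1 hIr hq (hB _ hq')
    · subst hq'; exact huI _ hq
    · rw [mem_singleton_iff] at hq'; subst hq'; exact hwI hq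
    · exact hA _ (hB _ hq')
    · exact hjk (hu (D.pos_inj hq'))
    · exact hwu _ (D.pos_inj hq')

/-- No triangle of bridges around a hub. -/
theorem hub_no_triangle {F : Set Plane} (hF : D.IsFace F) (hcl : ∀ v : V, D.pos v ∈ closure F)
    (I : Set Plane) (hI : I ⊆ D.image) (hIr : Disjoint I (D.rest S A R))
    (a b c w : V) (hab : a ≠ b) (hac : a ≠ c) (hbc : b ≠ c) (hwa : w ≠ a) (hwb : w ≠ b)
    (hwc : w ≠ c) (hw : w ∈ A)
    (haI : D.pos a ∉ I) (hbI : D.pos b ∉ I) (hcI : D.pos c ∉ I)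
    (hpa : JoinedIn (I ∪ {D.pos a, D.pos w}) (D.pos a) (D.pos w))
    (hpb : JoinedIn (I ∪ {D.pos b, D.pos w}) (D.pos b) (D.pos w))
    (z1 z2 z3 : Plane) (s : V)
    (hs1 : D.pos s ∈ D.bridge S A R z1)
    (h1a : a ∈ D.att S A R z1) (h1b : b ∈ D.att S A R z1)
    (h2b : b ∈ D.att S A R z2) (h2c : c ∈ D.att S A R z2)
    (h3a : a ∈ D.att S A R z3) (h3c : c ∈ D.att S A R z3)
    (hz2 : z2 ∈ D.rest S A R) (hz3 : z3 ∈ D.rest S A R)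
    (h12 : D.att S A R z1 ≠ D.att S A R z2) (h13 : D.att S A R z1 ≠ D.att S A R z3) : False := by
  have ha := ((D.mem_att S A R).1 h1a).1
  have hb := ((D.mem_att S A R).1 h1b).1
  have hc := ((D.mem_att S A R).1 h2c).1
  have hra : D.pos a ∉ D.rest S A R := D.pos_not_mem_rest S A R ha
  have hrb : D.pos b ∉ D.rest S A R := D.pos_not_mem_rest S A R hb
  have hrc : D.pos c ∉ D.rest S A R := D.pos_not_mem_rest S A R hc
  have hrw : D.pos w ∉ D.rest S A R := D.pos_not_mem_rest S A R hw
  have hB := fun z => D.bridge_subset S A R z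
  have hBI : ∀ z q, q ∈ D.bridge S A R z → q ∉ I := fun z q h h' =>
    disjoint_left.1 hIr h' (hB z h)
  have hBa : ∀ z, D.pos a ∉ D.bridge S A R z := fun z h => hra (hB z h)
  have hBb : ∀ z, D.pos b ∉ D.bridge S A R z := fun z h => hrb (hB z h)
  have hBc : ∀ z, D.pos c ∉ D.bridge S A R z := fun z h => hrc (hB z h)
  have hBw : ∀ z, D.pos w ∉ D.bridge S A R z := fun z h => hrw (hB z h)
  have d12 := disjoint_left.1 (D.bridge_disjoint S A R h12)
  have d13 := disjoint_left.1 (D.bridge_disjoint S A R h13)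
  have pab : D.pos a ≠ D.pos b := fun h => hab (D.pos_inj h)
  have pac : D.pos a ≠ D.pos c := fun h => hac (D.pos_inj h)
  have pbc : D.pos b ≠ D.pos c := fun h => hbc (D.pos_inj h)
  have pwa : D.pos w ≠ D.pos a := fun h => hwa (D.pos_inj h)
  have pwb : D.pos w ≠ D.pos b := fun h => hwb (D.pos_inj h)
  have pwc : D.pos w ≠ D.pos c := fun h => hwc (D.pos_inj h)
  have hBim : ∀ z, D.bridge S A R z ⊆ D.image := fun z => (hB z).trans (D.rest_subset_image S A R)
  refine D.no_k23 hF hcl (D.pos a) (D.pos b) ![s, w, c]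
    ![D.bridge S A R z1 ∪ {D.pos a}, I ∪ {D.pos a, D.pos w},
      D.bridge S A R z3 ∪ {D.pos a, D.pos c}]
    ![D.bridge S A R z1 ∪ {D.pos b}, I ∪ {D.pos b, D.pos w},
      D.bridge S A R z2 ∪ {D.pos b, D.pos c}] ?_ ?_ ?_ ?_ ?_
  · intro j
    fin_cases j
    · exact union_subset (hBim _) (by rintro _ rfl; exact D.pos_mem_image _)
    · exact union_subset hI (by rintro _ (rfl | rfl) <;> exact D.pos_mem_image _)
    · exact union_subset (hBim _) (by rintro _ (rfl | rfl) <;> exact D.pos_mem_image _)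
  · intro j
    fin_cases j
    · exact union_subset (hBim _) (by rintro _ rfl; exact D.pos_mem_image _)
    · exact union_subset hI (by rintro _ (rfl | rfl) <;> exact D.pos_mem_image _)
    · exact union_subset (hBim _) (by rintro _ (rfl | rfl) <;> exact D.pos_mem_image _)
  · intro j
    fin_cases j
    · exact (D.att_joined S A R h1a hs1).symm
    · exact hpa
    · refine ((D.att_joined S A R h3a (D.self_mem_bridge S A R hz3)).symm.mono ?_).trans
        ((D.att_joined S A R h3c (D.self_mem_bridge S A R hz3)).mono ?_)
      · exact union_subset_union_right _ (by simp)
      · exact union_subset_union_right _ (by simp)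
  · intro j
    fin_cases j
    · exact (D.att_joined S A R h1b hs1).symm
    · exact hpb
    · refine ((D.att_joined S A R h2b (D.self_mem_bridge S A R hz2)).symm.mono ?_).trans
        ((D.att_joined S A R h2c (D.self_mem_bridge S A R hz2)).mono ?_)
      · exact union_subset_union_right _ (by simp)
      · exact union_subset_union_right _ (by simp)
  · intro j k hjk
    refine disjoint_left.2 ?_
    intro q hq hq'
    fin_cases j <;> fin_cases k <;> first | exact absurd rfl hjk | skip
    · simp at hq hq'; grind
    · simp at hq hq'; grind
    · simp at hq hq'; grind
    · simp at hq hq'; grind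
    · simp at hq hq'; grind
    · simp at hq hq'; grind

end MultiDrawing

namespace MultiDrawing
variable {V E : Type} {ends : E → Sym2 V} [Fintype E]
variable (D : MultiDrawing V E ends) (S A : Finset V) (R : Finset E)

open Classical in
theorem card_edgesIn_le {k : ℕ} (W : Fin k → Finset V) (X : Finset E)
    (h : ∀ e ∈ edgesIn ends S, e ∈ X ∨ ∃ i, e ∈ edgesIn ends (W i)) :
    (edgesIn ends S).card ≤ X.card + ∑ i, (edgesIn ends (W i)).card := by
  have : edgesIn ends S ⊆ X ∪ Finset.univ.biUnion fun i => edgesIn ends (W i) := by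
    intro e he
    rcases h e he with h | ⟨i, hi⟩
    · exact Finset.mem_union_left _ h
    · exact Finset.mem_union_right _ (Finset.mem_biUnion.2 ⟨i, Finset.mem_univ _, hi⟩)
  refine (Finset.card_le_card this).trans ((Finset.card_union_le _ _).trans ?_)
  exact Nat.add_le_add_left Finset.card_biUnion_le _

open Classical in
/-- Finishing the count around a crossing. -/
theorem cross_finish (a b c d : V) (hab : a ≠ b) (hac : a ≠ c) (had : a ≠ d) (hbc : b ≠ c)
    (hbd : b ≠ d) (hcd : c ≠ d) (hA : A = {a, b, c, d}) (hAS : A ⊆ S) (hR : R.card ≤ 2)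
    (ih : ∀ T : Finset V, 2 ≤ T.card → T.card < S.card →
      2 * (edgesIn ends T).card + 8 ≤ 5 * T.card)
    (h1 : ∀ z ∈ D.rest S A R, ¬ (a ∈ D.att S A R z ∧ b ∈ D.att S A R z))
    (h2 : ∀ z ∈ D.rest S A R, ¬ (c ∈ D.att S A R z ∧ d ∈ D.att S A R z)) :
    2 * (edgesIn ends S).card + 8 ≤ 5 * S.card := by
  have hAc : A.card = 4 := by
    rw [hA]; exact Finset.card_eq_of_equiv_fin (by
      refine (Finset.equivFinOfCardEq ?_)
      simp [*])
  let Ai : Fin 4 → Finset V := ![{a, c}, {a, d}, {b, c}, {b, d}]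
  have hAi2 : ∀ i, (Ai i).card = 2 := by
    intro i; fin_cases i
    · exact Finset.card_pair hac
    · exact Finset.card_pair had
    · exact Finset.card_pair hbc
    · exact Finset.card_pair hbd
  have hAisub : ∀ i, Ai i ⊆ A := by
    intro i u hu
    subst hA
    fin_cases i <;> simp [Ai] at hu ⊢ <;> tauto
  have hatt : ∀ z ∈ D.rest S A R, ∃ i, D.att S A R z ⊆ Ai i := by
    intro z hz
    have hsub : ∀ u ∈ D.att S A R z, u = a ∨ u = b ∨ u = c ∨ u = d := by
      intro u hu
      have := ((D.mem_att S A R).1 hu).1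
      rw [hA] at this; simpa using this
    have q1 := h1 z hz
    have q2 := h2 z hz
    by_cases ha : a ∈ D.att S A R z
    · by_cases hc : c ∈ D.att S A R z
      · refine ⟨0, fun u hu => ?_⟩
        show u ∈ ({a, c} : Finset V)
        rcases hsub u hu with rfl | rfl | rfl | rfl <;> simp <;> tauto
      · refine ⟨1, fun u hu => ?_⟩
        show u ∈ ({a, d} : Finset V)
        rcases hsub u hu with rfl | rfl | rfl | rfl <;> simp <;> tauto
    · by_cases hc : c ∈ D.att S A R z
      · refine ⟨2, fun u hu => ?_⟩
        show u ∈ ({b, c} : Finset V)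
        rcases hsub u hu with rfl | rfl | rfl | rfl <;> simp <;> tauto
      · refine ⟨3, fun u hu => ?_⟩
        show u ∈ ({b, d} : Finset V)
        rcases hsub u hu with rfl | rfl | rfl | rfl <;> simp <;> tauto
  obtain ⟨W, hW1, hW2, hW3, hW4⟩ := D.exists_partition S A R hAS Ai hAisub hatt
  have hcount := card_edgesIn_le (ends := ends) S W R (fun e he => by
    by_cases h : e ∈ R
    · exact Or.inl h
    · exact Or.inr (hW4 e he h))
  have hi : ∀ i, 2 * (edgesIn ends (W i)).card + 8 ≤ 5 * (W i).card := by
    intro i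
    refine ih _ ?_ ?_
    · rw [← hAi2 i]; exact Finset.card_le_card (hW1 i)
    · have := hW2 i; rw [hAi2, hAc] at this; omega
  have i0 := hi 0
  have i1 := hi 1
  have i2 := hi 2
  have i3 := hi 3
  have hW3' : ∑ i : Fin 4, (W i).card + A.card = S.card + ∑ i : Fin 4, (Ai i).card := hW3
  have hcount' : (edgesIn ends S).card ≤ R.card + ∑ i : Fin 4, (edgesIn ends (W i)).card := hcount
  rw [Fin.sum_univ_four, Fin.sum_univ_four] at hW3'
  rw [Fin.sum_univ_four] at hcount'
  have a0 := hAi2 0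
  have a1 := hAi2 1
  have a2 := hAi2 2
  have a3 := hAi2 3
  omega

open Classical in
/-- Finishing the count by splitting along the edge `v b`. -/
theorem split_finish (v a b c : V) (hva : v ≠ a) (hvb : v ≠ b) (hvc : v ≠ c) (hab : a ≠ b)
    (hac : a ≠ c) (hbc : b ≠ c) (hA : A = {v, a, b, c}) (hAS : A ⊆ S)
    (e1 e2 e3 : E) (he1 : ends e1 = s(v, a)) (he2 : ends e2 = s(v, b)) (he3 : ends e3 = s(v, c))
    (hR : R = {e1, e2, e3})
    (ih : ∀ T : Finset V, 2 ≤ T.card → T.card < S.card →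
      2 * (edgesIn ends T).card + 8 ≤ 5 * T.card)
    (h1 : ∀ z ∈ D.rest S A R, ¬ (a ∈ D.att S A R z ∧ c ∈ D.att S A R z)) :
    2 * (edgesIn ends S).card + 8 ≤ 5 * S.card := by
  have hAc : A.card = 4 := by
    rw [hA]; exact Finset.card_eq_of_equiv_fin (by
      refine (Finset.equivFinOfCardEq ?_)
      simp [*])
  let Ai : Fin 2 → Finset V := ![{v, a, b}, {v, b, c}]
  have hAi2 : ∀ i, (Ai i).card = 3 := by
    intro i; fin_cases i
    · exact Finset.card_eq_three.2 ⟨v, a, b, hva, hvb, hab, rfl⟩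
    · exact Finset.card_eq_three.2 ⟨v, b, c, hvb, hvc, hbc, rfl⟩
  have hAisub : ∀ i, Ai i ⊆ A := by
    intro i u hu
    subst hA
    fin_cases i <;> simp [Ai] at hu ⊢ <;> tauto
  have hatt : ∀ z ∈ D.rest S A R, ∃ i, D.att S A R z ⊆ Ai i := by
    intro z hz
    have hsub : ∀ u ∈ D.att S A R z, u = v ∨ u = a ∨ u = b ∨ u = c := by
      intro u hu
      have := ((D.mem_att S A R).1 hu).1
      rw [hA] at this; simpa using this
    have q1 := h1 z hz
    by_cases ha : a ∈ D.att S A R z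
    · refine ⟨0, fun u hu => ?_⟩
      show u ∈ ({v, a, b} : Finset V)
      rcases hsub u hu with rfl | rfl | rfl | rfl <;> simp <;> tauto
    · refine ⟨1, fun u hu => ?_⟩
      show u ∈ ({v, b, c} : Finset V)
      rcases hsub u hu with rfl | rfl | rfl | rfl <;> simp <;> tauto
  obtain ⟨W, hW1, hW2, hW3, hW4⟩ := D.exists_partition S A R hAS Ai hAisub hatt
  have m0 : ∀ u, u = v ∨ u = a ∨ u = b → u ∈ W 0 := fun u hu => hW1 0 (by simpa [Ai] using hu)
  have m1 : ∀ u, u = v ∨ u = b ∨ u = c → u ∈ W 1 := fun u hu => hW1 1 (by simpa [Ai] using hu)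
  have k1 : e1 ∈ edgesIn ends (W 0) := mem_edgesIn.2 fun u hu => m0 u (by
    rw [he1, Sym2.mem_iff] at hu; tauto)
  have k2 : e2 ∈ edgesIn ends (W 0) := mem_edgesIn.2 fun u hu => m0 u (by
    rw [he2, Sym2.mem_iff] at hu; tauto)
  have k2' : e2 ∈ edgesIn ends (W 1) := mem_edgesIn.2 fun u hu => m1 u (by
    rw [he2, Sym2.mem_iff] at hu; tauto)
  have k3 : e3 ∈ edgesIn ends (W 1) := mem_edgesIn.2 fun u hu => m1 u (by
    rw [he3, Sym2.mem_iff] at hu; tauto)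
  have hsub : edgesIn ends S ⊆ edgesIn ends (W 0) ∪ edgesIn ends (W 1) := by
    intro e he
    rw [Finset.mem_union]
    by_cases h : e ∈ R
    · rw [hR] at h; simp only [Finset.mem_insert, Finset.mem_singleton] at h
      rcases h with rfl | rfl | rfl
      · exact Or.inl k1
      · exact Or.inl k2
      · exact Or.inr k3
    · obtain ⟨i, hi⟩ := hW4 e he h
      fin_cases i
      · exact Or.inl hi
      · exact Or.inr hi
  have hc1 := Finset.card_le_card hsub
  have hc2 := Finset.card_union_add_card_inter (edgesIn ends (W 0)) (edgesIn ends (W 1))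
  have hc3 : 0 < (edgesIn ends (W 0) ∩ edgesIn ends (W 1)).card :=
    Finset.card_pos.2 ⟨e2, Finset.mem_inter.2 ⟨k2, k2'⟩⟩
  have hi : ∀ i, 2 * (edgesIn ends (W i)).card + 8 ≤ 5 * (W i).card := by
    intro i
    refine ih _ ?_ ?_
    · have := Finset.card_le_card (hW1 i); rw [hAi2] at this; omega
    · have := hW2 i; rw [hAi2, hAc] at this; omega
  have i0 := hi 0
  have i1 := hi 1
  have hW3' : ∑ i : Fin 2, (W i).card + A.card = S.card + ∑ i : Fin 2, (Ai i).card := hW3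
  rw [Fin.sum_univ_two, Fin.sum_univ_two] at hW3'
  have a0 := hAi2 0
  have a1 := hAi2 1
  omega

open Classical in
/-- Finishing the count around a `K_4`. -/
theorem k4_finish (v a b c : V) (hva : v ≠ a) (hvb : v ≠ b) (hvc : v ≠ c) (hab : a ≠ b)
    (hac : a ≠ c) (hbc : b ≠ c) (hA : A = {v, a, b, c}) (hAS : A ⊆ S)
    (e1 e2 e3 : E) (he1 : ends e1 = s(v, a)) (he2 : ends e2 = s(v, b)) (he3 : ends e3 = s(v, c))
    (X : Finset E) (hX : X.card ≤ 3)
    (hR : R = {e1, e2, e3} ∪ X)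
    (ih : ∀ T : Finset V, 2 ≤ T.card → T.card < S.card →
      2 * (edgesIn ends T).card + 8 ≤ 5 * T.card)
    (h1 : ∀ z ∈ D.rest S A R, ¬ (a ∈ D.att S A R z ∧ b ∈ D.att S A R z))
    (h2 : ∀ z ∈ D.rest S A R, ¬ (a ∈ D.att S A R z ∧ c ∈ D.att S A R z))
    (h3 : ∀ z ∈ D.rest S A R, ¬ (b ∈ D.att S A R z ∧ c ∈ D.att S A R z)) :
    2 * (edgesIn ends S).card + 8 ≤ 5 * S.card := by
  have hAc : A.card = 4 := by
    rw [hA]; exact Finset.card_eq_of_equiv_fin (by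
      refine (Finset.equivFinOfCardEq ?_)
      simp [*])
  let Ai : Fin 3 → Finset V := ![{v, a}, {v, b}, {v, c}]
  have hAi2 : ∀ i, (Ai i).card = 2 := by
    intro i; fin_cases i
    · exact Finset.card_pair hva
    · exact Finset.card_pair hvb
    · exact Finset.card_pair hvc
  have hAisub : ∀ i, Ai i ⊆ A := by
    intro i u hu
    subst hA
    fin_cases i <;> simp [Ai] at hu ⊢ <;> tauto
  have hatt : ∀ z ∈ D.rest S A R, ∃ i, D.att S A R z ⊆ Ai i := by
    intro z hz
    have hsub : ∀ u ∈ D.att S A R z, u = v ∨ u = a ∨ u = b ∨ u = c := by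
      intro u hu
      have := ((D.mem_att S A R).1 hu).1
      rw [hA] at this; simpa using this
    have q1 := h1 z hz
    have q2 := h2 z hz
    have q3 := h3 z hz
    by_cases ha : a ∈ D.att S A R z
    · refine ⟨0, fun u hu => ?_⟩
      show u ∈ ({v, a} : Finset V)
      rcases hsub u hu with rfl | rfl | rfl | rfl <;> simp <;> tauto
    by_cases hb : b ∈ D.att S A R z
    · refine ⟨1, fun u hu => ?_⟩
      show u ∈ ({v, b} : Finset V)
      rcases hsub u hu with rfl | rfl | rfl | rfl <;> simp <;> tauto
    · refine ⟨2, fun u hu => ?_⟩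
      show u ∈ ({v, c} : Finset V)
      rcases hsub u hu with rfl | rfl | rfl | rfl <;> simp <;> tauto
  obtain ⟨W, hW1, hW2, hW3, hW4⟩ := D.exists_partition S A R hAS Ai hAisub hatt
  have m0 : ∀ u, u = v ∨ u = a → u ∈ W 0 := fun u hu => hW1 0 (by simpa [Ai] using hu)
  have m1 : ∀ u, u = v ∨ u = b → u ∈ W 1 := fun u hu => hW1 1 (by simpa [Ai] using hu)
  have m2 : ∀ u, u = v ∨ u = c → u ∈ W 2 := fun u hu => hW1 2 (by simpa [Ai] using hu)
  have k1 : e1 ∈ edgesIn ends (W 0) := mem_edgesIn.2 fun u hu => m0 u (by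
    rw [he1, Sym2.mem_iff] at hu; tauto)
  have k2 : e2 ∈ edgesIn ends (W 1) := mem_edgesIn.2 fun u hu => m1 u (by
    rw [he2, Sym2.mem_iff] at hu; tauto)
  have k3 : e3 ∈ edgesIn ends (W 2) := mem_edgesIn.2 fun u hu => m2 u (by
    rw [he3, Sym2.mem_iff] at hu; tauto)
  have hcount := card_edgesIn_le (ends := ends) S W X (fun e he => by
    by_cases h : e ∈ R
    · rw [hR] at h
      simp only [Finset.mem_union, Finset.mem_insert, Finset.mem_singleton] at h
      rcases h with (rfl | rfl | rfl) | h
      · exact Or.inr ⟨0, k1⟩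
      · exact Or.inr ⟨1, k2⟩
      · exact Or.inr ⟨2, k3⟩
      · exact Or.inl h
    · exact Or.inr (hW4 e he h))
  have hi : ∀ i, 2 * (edgesIn ends (W i)).card + 8 ≤ 5 * (W i).card := by
    intro i
    refine ih _ ?_ ?_
    · rw [← hAi2 i]; exact Finset.card_le_card (hW1 i)
    · have := hW2 i; rw [hAi2, hAc] at this; omega
  have i0 := hi 0
  have i1 := hi 1
  have i2 := hi 2
  have hW3' : ∑ i : Fin 3, (W i).card + A.card = S.card + ∑ i : Fin 3, (Ai i).card := hW3
  have hcount' : (edgesIn ends S).card ≤ X.card + ∑ i : Fin 3, (edgesIn ends (W i)).card := hcount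
  rw [Fin.sum_univ_three, Fin.sum_univ_three] at hW3'
  rw [Fin.sum_univ_three] at hcount'
  have a0 := hAi2 0
  have a1 := hAi2 1
  have a2 := hAi2 2
  omega

open Classical in
/-- Small degrees. -/
theorem low_degree (hinj : Function.Injective ends) (hnd : ∀ e, ¬ (ends e).IsDiag)
    (hS : 2 ≤ S.card)
    (h : ∀ v ∈ S, ((edgesIn ends S).filter fun e => v ∈ ends e).card ≤ 2) :
    2 * (edgesIn ends S).card + 8 ≤ 5 * S.card := by
  have key : 2 * (edgesIn ends S).card =
      ∑ v ∈ S, ((edgesIn ends S).filter fun e => v ∈ ends e).card := by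
    have h1 := Finset.sum_card_bipartiteAbove_eq_sum_card_bipartiteBelow
      (s := S) (t := edgesIn ends S) (fun v e => v ∈ ends e)
    simp only [Finset.bipartiteAbove, Finset.bipartiteBelow] at h1
    rw [h1, Finset.sum_congr rfl (g := fun _ => 2)]
    · simp [mul_comm]
    · intro e he
      obtain ⟨a, b, hab⟩ : ∃ a b, ends e = s(a, b) := ⟨_, _, (Quot.out_eq (ends e)).symm⟩
      have hne : a ≠ b := by
        intro h; exact hnd e (by rw [hab, h]; simp)
      have hm := mem_edgesIn.1 he
      rw [← Finset.card_pair hne]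
      congr 1
      ext u
      simp only [Finset.mem_filter, Finset.mem_insert, Finset.mem_singleton]
      rw [hab] at hm ⊢
      rw [Sym2.mem_iff]
      constructor
      · exact fun h => h.2
      · exact fun h => ⟨hm u (Sym2.mem_iff.2 h), h⟩
  have hle : 2 * (edgesIn ends S).card ≤ S.card * 2 := by
    rw [key]; exact Finset.sum_le_card_nsmul _ _ _ h
  rcases hS.lt_or_eq with h3 | h2
  · omega
  · obtain ⟨x, y, hxy, rfl⟩ := Finset.card_eq_two.1 h2.symm
    have : (edgesIn ends {x, y}).card ≤ 1 := by
      refine Finset.card_le_one.2 ?_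
      have hh : ∀ e ∈ edgesIn ends {x, y}, ends e = s(x, y) := by
        intro e he
        obtain ⟨a, b, hab⟩ : ∃ a b, ends e = s(a, b) := ⟨_, _, (Quot.out_eq (ends e)).symm⟩
        have hne : a ≠ b := by
          intro h; exact hnd e (by rw [hab, h]; simp)
        have hm := mem_edgesIn.1 he
        have ha := hm a (by rw [hab]; simp)
        have hb := hm b (by rw [hab]; simp)
        simp only [Finset.mem_insert, Finset.mem_singleton] at ha hb
        rw [hab, Sym2.eq_iff]
        grind
      intro e he f hf
      exact hinj ((hh e he).trans (hh f hf).symm)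
    omega

end MultiDrawing

namespace MultiDrawing
variable {V E : Type} {ends : E → Sym2 V} [Finite V] [Fintype E]
variable (D : MultiDrawing V E ends) (S A : Finset V) (R : Finset E)

/-- A pair of vertices is used if some bridge attaches to both. -/
def Used (u v : V) : Prop := ∃ z ∈ D.rest S A R, u ∈ D.att S A R z ∧ v ∈ D.att S A R z

theorem Used.symm {u v : V} (h : D.Used S A R u v) : D.Used S A R v u := by
  obtain ⟨z, hz, h1, h2⟩ := h
  exact ⟨z, hz, h2, h1⟩

/-- A hub: a connected piece `I` of the drawing around `p`, disjoint from the rest and reaching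
all the vertices of `A'`. -/
structure Hub (A' : Finset V) (I : Set Plane) (p : Plane) : Prop where
  sub : I ⊆ D.image
  disj : Disjoint I (D.rest S A R)
  notMem : ∀ u ∈ A', D.pos u ∉ I
  join : ∀ u ∈ A', JoinedIn (I ∪ {D.pos u}) p (D.pos u)

variable {D S A R}
variable {F : Set Plane} {A' : Finset V} {I : Set Plane} {p : Plane}

theorem Hub.no_triple (H : D.Hub S A R A' I p) (hF : D.IsFace F)
    (hcl : ∀ v : V, D.pos v ∈ closure F) {u v w : V} (hu : u ∈ A') (hv : v ∈ A') (hw : w ∈ A')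
    (huv : u ≠ v) (huw : u ≠ w) (hvw : v ≠ w) {z : Plane} (hz : z ∈ D.rest S A R)
    (h1 : u ∈ D.att S A R z) (h2 : v ∈ D.att S A R z) (h3 : w ∈ D.att S A R z) : False := by
  refine D.hub_no_triple S A R hF hcl I H.sub H.disj p ![u, v, w] ?_ ?_ ?_ z hz ?_
  · intro i j h
    fin_cases i <;> fin_cases j <;> simp_all
  · intro j; fin_cases j
    · exact H.notMem u hu
    · exact H.notMem v hv
    · exact H.notMem w hw
  · intro j; fin_cases j
    · exact H.join u hu
    · exact H.join v hv
    · exact H.join w hw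
  · intro j; fin_cases j
    · exact h1
    · exact h2
    · exact h3

theorem Hub.no_star (H : D.Hub S A R A' I p) (hF : D.IsFace F)
    (hcl : ∀ v : V, D.pos v ∈ closure F) {u v w x : V} (hu : u ∈ A') (hv : v ∈ A') (hw : w ∈ A')
    (hx : x ∈ A')
    (huv : u ≠ v) (huw : u ≠ w) (hvw : v ≠ w) (hxu : x ≠ u) (hxv : x ≠ v) (hxw : x ≠ w)
    (h1 : D.Used S A R x u) (h2 : D.Used S A R x v) (h3 : D.Used S A R x w) : False := by
  obtain ⟨z1, hz1, h1x, h1u⟩ := h1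
  obtain ⟨z2, hz2, h2x, h2v⟩ := h2
  obtain ⟨z3, hz3, h3x, h3w⟩ := h3
  refine D.hub_no_star S A R hF hcl I H.sub H.disj p ![u, v, w] ?_ ?_ ?_ x (H.notMem x hx) ?_
    ![z1, z2, z3] ?_ ?_ ?_
  · intro i j h
    fin_cases i <;> fin_cases j <;> simp_all
  · intro j; fin_cases j
    · exact H.notMem u hu
    · exact H.notMem v hv
    · exact H.notMem w hw
  · intro j; fin_cases j
    · exact H.join u hu
    · exact H.join v hv
    · exact H.join w hw
  · intro j; fin_cases j
    · exact hxu.symm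
    · exact hxv.symm
    · exact hxw.symm
  · intro j; fin_cases j
    · exact hz1
    · exact hz2
    · exact hz3
  · intro j; fin_cases j
    · exact h1u
    · exact h2v
    · exact h3w
  · intro j; fin_cases j
    · exact h1x
    · exact h2x
    · exact h3x

theorem Hub.join2 (H : D.Hub S A R A' I p) {u w : V} (hu : u ∈ A')
    (hw : JoinedIn (I ∪ {D.pos w}) p (D.pos w)) :
    JoinedIn (I ∪ {D.pos u, D.pos w}) (D.pos u) (D.pos w) := by
  refine ((H.join u hu).symm.mono ?_).trans (hw.mono ?_)
  · exact union_subset_union_right _ (by simp)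
  · exact union_subset_union_right _ (by simp)

theorem Hub.no_triangle (H : D.Hub S A R A' I p) (hF : D.IsFace F)
    (hcl : ∀ v : V, D.pos v ∈ closure F) {u v x w : V} (hu : u ∈ A') (hv : v ∈ A') (hx : x ∈ A')
    (hw : w ∈ A) (hwj : JoinedIn (I ∪ {D.pos w}) p (D.pos w))
    (huv : u ≠ v) (hux : u ≠ x) (hvx : v ≠ x) (hwu : w ≠ u) (hwv : w ≠ v) (hwx : w ≠ x)
    {z : Plane} (hz : z ∈ D.rest S A R) {s : V} (hs : D.pos s ∈ D.bridge S A R z)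
    (h1u : u ∈ D.att S A R z) (h1v : v ∈ D.att S A R z)
    (h2 : D.Used S A R v x) (h3 : D.Used S A R u x) : False := by
  obtain ⟨z2, hz2, h2v, h2x⟩ := h2
  obtain ⟨z3, hz3, h3u, h3x⟩ := h3
  refine D.hub_no_triangle S A R hF hcl I H.sub H.disj u v x w huv hux hvx hwu hwv hwx hw
    (H.notMem u hu) (H.notMem v hv) (H.notMem x hx) (H.join2 hu hwj) (H.join2 hv hwj) z z2 z3 s hs
    h1u h1v h2v h2x h3u h3x hz2 hz3 ?_ ?_
  · intro h
    exact H.no_triple hF hcl hu hv hx huv hux hvx hz h1u h1v (h ▸ h2x)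
  · intro h
    exact H.no_triple hF hcl hu hv hx huv hux hvx hz h1u h1v (h ▸ h3x)

open Classical in
theorem cross_case (hinj : Function.Injective ends) (hnd : ∀ e, ¬ (ends e).IsDiag)
    (hF : D.IsFace F) (hcl : ∀ v : V, D.pos v ∈ closure F)
    (a b c d : V) (hab : a ≠ b) (hac : a ≠ c) (had : a ≠ d) (hbc : b ≠ c)
    (hbd : b ≠ d) (hcd : c ≠ d) (hA : A = {a, b, c, d}) (hAS : A ⊆ S) (hR : R.card ≤ 2)
    (e0 f0 : E) (he0 : ends e0 = s(a, b)) (hf0 : ends f0 = s(c, d)) (he0R : e0 ∈ R)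
    (hf0R : f0 ∈ R) (H : D.Hub S A R A I p)
    (ih : ∀ T : Finset V, 2 ≤ T.card → T.card < S.card →
      2 * (edgesIn ends T).card + 8 ≤ 5 * T.card) :
    2 * (edgesIn ends S).card + 8 ≤ 5 * S.card := by
  by_contra hcon
  have ma : a ∈ A := by simp [hA]
  have mb : b ∈ A := by simp [hA]
  have mc : c ∈ A := by simp [hA]
  have md : d ∈ A := by simp [hA]
  have fin : ∀ a b c d : V, a ≠ b → a ≠ c → a ≠ d → b ≠ c → b ≠ d → c ≠ d → A = {a, b, c, d} →
      D.Used S A R a b ∨ D.Used S A R c d := by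
    intro a b c d hab hac had hbc hbd hcd hA
    by_contra! h
    refine hcon (D.cross_finish S A R a b c d hab hac had hbc hbd hcd hA hAS hR ih ?_ ?_)
    · exact fun z hz hz' => h.1 ⟨z, hz, hz'⟩
    · exact fun z hz hz' => h.2 ⟨z, hz, hz'⟩
  have tri : ∀ u v x w : V, ∀ e ∈ R, ends e = s(u, v) → u ≠ v → u ≠ x → u ≠ w → v ≠ x → v ≠ w →
      x ≠ w → A = {u, v, x, w} → D.Used S A R u v → D.Used S A R v x → D.Used S A R u x →
      False := by
    intro u v x w e heR he huv hux huw hvx hvw hxw hA h1 h2 h3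
    have mu : u ∈ A := by simp [hA]
    have mv : v ∈ A := by simp [hA]
    have mx : x ∈ A := by simp [hA]
    have mw : w ∈ A := by simp [hA]
    obtain ⟨z, hz, hzu, hzv⟩ := h1
    have hs : ∃ s, D.pos s ∈ D.bridge S A R z := by
      rcases D.att_edge S A R hnd hzu with ⟨s, -, -, hs⟩ | ⟨f, hf, hfR, u', hu', hne, hatt⟩
      · exact ⟨s, hs⟩
      · exfalso
        by_cases h : u' = v
        · subst h
          exact hfR (hinj (hu'.trans he.symm) ▸ heR)
        · exact H.no_triple hF hcl mu mv ((D.mem_att S A R).1 hatt).1 huv hne.symm (Ne.symm h)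
            hz hzu hzv hatt
    obtain ⟨s, hs⟩ := hs
    exact H.no_triangle hF hcl mu mv mx mw (H.join w mw) huv hux hvx huw.symm hvw.symm hxw.symm
      hz hs hzu hzv h2 h3
  have q1 := fin a b c d hab hac had hbc hbd hcd hA
  have q2 := fin a c b d hac hab had hbc.symm hcd hbd (by rw [hA]; ext; simp; tauto)
  have q3 := fin a d b c had hab hac hbd.symm hcd.symm hbc (by rw [hA]; ext; simp; tauto)
  rcases q1 with q1 | q1 <;> rcases q2 with q2 | q2 <;> rcases q3 with q3 | q3
  · exact H.no_star hF hcl mb mc md ma hbc hbd hcd hab hac had q1 q2 q3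
  · exact tri a b c d e0 he0R he0 hab hac had hbc hbd hcd hA q1 q3 q2
  · exact tri a b d c e0 he0R he0 hab had hac hbd hbc hcd.symm (by rw [hA]; ext; simp; tauto)
      q1 q2 q3
  · exact H.no_star hF hcl ma mc md mb hac had hcd hab.symm hbc hbd (q1.symm) q3 q2
  · exact tri c d a b f0 hf0R hf0 hcd hac.symm hbc.symm had.symm hbd.symm hab
      (by rw [hA]; ext; simp; tauto) q1 q3.symm q2.symm
  · exact H.no_star hF hcl ma mb md mc hab had hbd hac.symm hbc.symm hcd q2.symm q3.symm q1
  · exact H.no_star hF hcl ma mb mc md hab hac hbc had.symm hbd.symm hcd.symm q3.symm q2.symm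
      q1.symm
  · exact tri c d b a f0 hf0R hf0 hcd hbc.symm hac.symm hbd.symm had.symm hab.symm
      (by rw [hA]; ext; simp; tauto) q1 q2.symm q3.symm

open Classical in
theorem degree_case (hinj : Function.Injective ends) (hnd : ∀ e, ¬ (ends e).IsDiag)
    (hF : D.IsFace F) (hcl : ∀ v : V, D.pos v ∈ closure F)
    (v a b c : V) (hva : v ≠ a) (hvb : v ≠ b) (hvc : v ≠ c) (hab : a ≠ b)
    (hac : a ≠ c) (hbc : b ≠ c) (hA : A = {v, a, b, c}) (hAS : A ⊆ S)
    (e1 e2 e3 : E) (he1 : ends e1 = s(v, a)) (he2 : ends e2 = s(v, b)) (he3 : ends e3 = s(v, c))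
    (hR : R = {e1, e2, e3})
    (H : D.Hub S A R {a, b, c} I (D.pos v)) (hv : D.pos v ∈ I)
    (ih : ∀ T : Finset V, 2 ≤ T.card → T.card < S.card →
      2 * (edgesIn ends T).card + 8 ≤ 5 * T.card) :
    2 * (edgesIn ends S).card + 8 ≤ 5 * S.card := by
  by_contra hcon
  have ma : a ∈ ({a, b, c} : Finset V) := by simp
  have mb : b ∈ ({a, b, c} : Finset V) := by simp
  have mc : c ∈ ({a, b, c} : Finset V) := by simp
  have mv : v ∈ A := by simp [hA]
  have q1 : D.Used S A R a c := by
    by_contra h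
    exact hcon (D.split_finish S A R v a b c hva hvb hvc hab hac hbc hA hAS e1 e2 e3 he1 he2 he3
      hR ih fun z hz hz' => h ⟨z, hz, hz'⟩)
  have q2 : D.Used S A R a b := by
    by_contra h
    exact hcon (D.split_finish S A R v a c b hva hvc hvb hac hab hbc.symm
      (by rw [hA]; ext; simp; tauto) hAS e1 e3 e2 he1 he3 he2
      (by rw [hR]; ext; simp; tauto) ih fun z hz hz' => h ⟨z, hz, hz'⟩)
  have q3 : D.Used S A R b c := by
    by_contra h
    exact hcon (D.split_finish S A R v b a c hvb hva hvc hab.symm hbc hac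
      (by rw [hA]; ext; simp; tauto) hAS e2 e1 e3 he2 he1 he3
      (by rw [hR]; ext; simp; tauto) ih fun z hz hz' => h ⟨z, hz, hz'⟩)
  have hvj : JoinedIn (I ∪ {D.pos v}) (D.pos v) (D.pos v) := JoinedIn.refl (Or.inl hv)
  have n1 : ∀ z ∈ D.rest S A R, a ∈ D.att S A R z → b ∈ D.att S A R z →
      ∀ s, D.pos s ∉ D.bridge S A R z := fun z hz h1 h2 s hs =>
    H.no_triangle hF hcl ma mb mc mv hvj hab hac hbc hva hvb hvc hz hs h1 h2 q3 q1
  have n2 : ∀ z ∈ D.rest S A R, a ∈ D.att S A R z → c ∈ D.att S A R z →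
      ∀ s, D.pos s ∉ D.bridge S A R z := fun z hz h1 h2 s hs =>
    H.no_triangle hF hcl ma mc mb mv hvj hac hab hbc.symm hva hvc hvb hz hs h1 h2 q3.symm q2
  have n3 : ∀ z ∈ D.rest S A R, b ∈ D.att S A R z → c ∈ D.att S A R z →
      ∀ s, D.pos s ∉ D.bridge S A R z := fun z hz h1 h2 s hs =>
    H.no_triangle hF hcl mb mc ma mv hvj hbc hab.symm hac.symm hvb hvc hva hz hs h1 h2
      q1.symm q2.symm
  let X : Finset E := (edgesIn ends S).filter
    fun e => ends e ∈ ({s(a, b), s(a, c), s(b, c)} : Finset (Sym2 V))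
  have hX : X.card ≤ 3 := by
    have : X.card ≤ ({s(a, b), s(a, c), s(b, c)} : Finset (Sym2 V)).card := by
      refine Finset.card_le_card_of_injOn ends ?_ hinj.injOn
      intro e he
      exact (Finset.mem_filter.1 he).2
    exact this.trans Finset.card_le_three
  have hRX : ({e1, e2, e3} : Finset E) ⊆ {e1, e2, e3} ∪ X := Finset.subset_union_left
  have hrest : D.rest S A ({e1, e2, e3} ∪ X) ⊆ D.rest S A R := by
    rintro q (⟨e, h1, h2, h3⟩ | h)
    · exact Or.inl ⟨e, h1, fun h => h2 (hRX (hR ▸ h)), h3⟩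
    · exact Or.inr h
  have hattsub : ∀ z u, u ∈ D.att S A ({e1, e2, e3} ∪ X) z → u ∈ D.att S A R z := by
    intro z u hu
    obtain ⟨h1, e, h2, h3, h4, h5⟩ := (D.mem_att S A _).1 hu
    exact (D.mem_att S A R).2 ⟨h1, e, h2, fun h => h3 (hRX (hR ▸ h)), h4, h5.mono hrest⟩
  have hbr : ∀ z, D.bridge S A ({e1, e2, e3} ∪ X) z ⊆ D.bridge S A R z :=
    fun z q hq => JoinedIn.mono hq hrest
  have key : ∀ z u, u ∈ D.att S A ({e1, e2, e3} ∪ X) z → u ≠ v →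
      (∀ s, D.pos s ∉ D.bridge S A R z) → False := by
    intro z u hu huv hs
    rcases D.att_edge S A _ hnd hu with ⟨s, -, -, h⟩ | ⟨e, he, heR, u', hu', hne, hatt⟩
    · exact hs s (hbr z h)
    · have m1 := ((D.mem_att S A _).1 hu).1
      have m2 := ((D.mem_att S A _).1 hatt).1
      rw [hA] at m1 m2
      simp only [Finset.mem_insert, Finset.mem_singleton] at m1 m2
      apply heR
      simp only [Finset.mem_union, Finset.mem_insert, Finset.mem_singleton, X, Finset.mem_filter]
      rcases m2 with rfl | m2
      · left
        rcases m1 with h | rfl | rfl | rfl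
        · exact absurd h huv
        · left; exact hinj (by rw [hu', he1, Sym2.eq_swap])
        · right; left; exact hinj (by rw [hu', he2, Sym2.eq_swap])
        · right; right; exact hinj (by rw [hu', he3, Sym2.eq_swap])
      · right
        refine ⟨he, ?_⟩
        rw [hu']
        simp only [Sym2.eq_iff]
        rcases m1 with h | m1
        · exact absurd h huv
        · rcases m1 with rfl | rfl | rfl <;> rcases m2 with rfl | rfl | rfl <;> simp at hne ⊢
  refine hcon (D.k4_finish S A _ v a b c hva hvb hvc hab hac hbc hA hAS e1 e2 e3 he1 he2 he3
    X hX rfl ih ?_ ?_ ?_)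
  · rintro z hz ⟨h1, h2⟩
    exact key z a h1 hva.symm (n1 z (hrest hz) (hattsub _ _ h1) (hattsub _ _ h2))
  · rintro z hz ⟨h1, h2⟩
    exact key z a h1 hva.symm (n2 z (hrest hz) (hattsub _ _ h1) (hattsub _ _ h2))
  · rintro z hz ⟨h1, h2⟩
    exact key z b h1 hvb.symm (n3 z (hrest hz) (hattsub _ _ h1) (hattsub _ _ h2))

theorem inter_disj_rest (hAS : A ⊆ S) {e : E} (h : ∀ f ∈ edgesIn ends S, f ∉ R →
    Disjoint (D.inter e) (D.inter f)) : Disjoint (D.inter e) (D.rest S A R) := by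
  refine disjoint_left.2 ?_
  rintro q hq (⟨f, h1, h2, h3⟩ | ⟨w, -, -, rfl⟩)
  · exact disjoint_left.1 (h f h1 h2) hq h3
  · exact D.arc_avoid e w hq

open Classical in
theorem main_bound (hinj : Function.Injective ends) (hnd : ∀ e, ¬ (ends e).IsDiag)
    (hone : D.IsOnePlanarD) (hF : D.IsFace F) (hcl : ∀ v : V, D.pos v ∈ closure F) :
    ∀ (n : ℕ) (S : Finset V), S.card = n → 2 ≤ S.card →
      2 * (edgesIn ends S).card + 8 ≤ 5 * S.card := by
  intro n
  induction n using Nat.strong_induction_on with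
  | _ n IH =>
  intro S hSn hS
  have ih : ∀ T : Finset V, 2 ≤ T.card → T.card < S.card →
      2 * (edgesIn ends T).card + 8 ≤ 5 * T.card := fun T h1 h2 =>
    IH T.card (hSn ▸ h2) T rfl h1
  have hne : ∀ e u v, ends e = s(u, v) → u ≠ v := by
    rintro e u v h rfl
    exact hnd e (by rw [h]; simp)
  by_cases hc : ∃ e0 ∈ edgesIn ends S, ∃ f0 ∈ edgesIn ends S, f0 ≠ e0 ∧
      (D.inter e0 ∩ D.inter f0).Nonempty
  · obtain ⟨e0, he0, f0, hf0, hef, p, hp⟩ := hc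
    obtain ⟨a, b, hab⟩ : ∃ a b, ends e0 = s(a, b) := ⟨_, _, (Quot.out_eq (ends e0)).symm⟩
    obtain ⟨c, d, hcd⟩ : ∃ a b, ends f0 = s(a, b) := ⟨_, _, (Quot.out_eq (ends f0)).symm⟩
    have hni := D.no_incident_cross e0 f0 hef.symm ⟨p, hp⟩
    have hS1 := mem_edgesIn.1 he0
    have hS2 := mem_edgesIn.1 hf0
    rw [hab] at hS1
    rw [hcd] at hS2
    simp only [Sym2.mem_iff, forall_eq_or_imp, forall_eq] at hS1 hS2
    have n1 : a ≠ c := fun h => hni a ⟨by simp [hab], by simp [hcd, h]⟩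
    have n2 : a ≠ d := fun h => hni a ⟨by simp [hab], by simp [hcd, h]⟩
    have n3 : b ≠ c := fun h => hni b ⟨by simp [hab], by simp [hcd, h]⟩
    have n4 : b ≠ d := fun h => hni b ⟨by simp [hab], by simp [hcd, h]⟩
    have hAS : ({a, b, c, d} : Finset V) ⊆ S := by
      intro u hu
      simp only [Finset.mem_insert, Finset.mem_singleton] at hu
      rcases hu with rfl | rfl | rfl | rfl
      exacts [hS1.1, hS1.2, hS2.1, hS2.2]
    have hunc : ∀ f ∈ edgesIn ends S, f ∉ ({e0, f0} : Finset E) →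
        Disjoint (D.inter e0) (D.inter f) ∧ Disjoint (D.inter f0) (D.inter f) := by
      intro f _ hf
      simp only [Finset.mem_insert, Finset.mem_singleton, not_or] at hf
      constructor
      · refine disjoint_left.2 fun q h1 h2 => hf.2 ?_
        have := hone e0 (show (f, q) ∈ D.crossSet e0 from ⟨hf.1, h1, h2⟩)
          (show (f0, p) ∈ D.crossSet e0 from ⟨hef, hp⟩)
        exact congrArg Prod.fst this
      · refine disjoint_left.2 fun q h1 h2 => hf.1 ?_
        have := hone f0 (show (f, q) ∈ D.crossSet f0 from ⟨hf.2, h1, h2⟩)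
          (show (e0, p) ∈ D.crossSet f0 from ⟨hef.symm, hp.2, hp.1⟩)
        exact congrArg Prod.fst this
    refine cross_case (D := D) (S := S) (A := {a, b, c, d}) (R := {e0, f0}) (p := p)
      (I := D.inter e0 ∪ D.inter f0) hinj hnd hF hcl a b c d (hne _ _ _ hab) n1 n2 n3 n4
      (hne _ _ _ hcd) rfl hAS Finset.card_le_two e0 f0 hab hcd (by simp) (by simp) ?_ ih
    refine ⟨union_subset (D.inter_subset_image _) (D.inter_subset_image _),
      disjoint_union_left.2 ⟨inter_disj_rest hAS fun f h1 h2 => (hunc f h1 h2).1,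
        inter_disj_rest hAS fun f h1 h2 => (hunc f h1 h2).2⟩, ?_, ?_⟩
    · rintro u - (h | h)
      · exact D.arc_avoid _ _ h
      · exact D.arc_avoid _ _ h
    · intro u hu
      have : u ∈ ends e0 ∨ u ∈ ends f0 := by
        rw [hab, hcd, Sym2.mem_iff, Sym2.mem_iff]
        simpa [or_assoc] using hu
      rcases this with h | h
      · exact (D.end_joined e0 h hp.1).mono (union_subset_union_left _ subset_union_left)
      · exact (D.end_joined f0 h hp.2).mono (union_subset_union_left _ subset_union_right)
  · push Not at hc
    have hdis : ∀ e ∈ edgesIn ends S, ∀ f ∈ edgesIn ends S, f ≠ e →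
        Disjoint (D.inter e) (D.inter f) := fun e he f hf hne =>
      disjoint_iff_inter_eq_empty.2 (hc e he f hf hne)
    by_cases hd : ∀ v ∈ S, ((edgesIn ends S).filter fun e => v ∈ ends e).card ≤ 2
    · exact low_degree S hinj hnd hS hd
    · push Not at hd
      obtain ⟨v, hvS, hv⟩ := hd
      obtain ⟨e1, h1, e2, h2, e3, h3, h12, h13, h23⟩ := Finset.two_lt_card.1 hv
      rw [Finset.mem_filter] at h1 h2 h3
      obtain ⟨a, ha⟩ := Sym2.mem_iff_exists.1 h1.2
      obtain ⟨b, hb⟩ := Sym2.mem_iff_exists.1 h2.2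
      obtain ⟨c, hc'⟩ := Sym2.mem_iff_exists.1 h3.2
      have hab : a ≠ b := fun h => h12 (hinj (by rw [ha, hb, h]))
      have hac : a ≠ c := fun h => h13 (hinj (by rw [ha, hc', h]))
      have hbc : b ≠ c := fun h => h23 (hinj (by rw [hb, hc', h]))
      have hva := hne _ _ _ ha
      have hvb := hne _ _ _ hb
      have hvc := hne _ _ _ hc'
      have hAS : ({v, a, b, c} : Finset V) ⊆ S := by
        intro u hu
        simp only [Finset.mem_insert, Finset.mem_singleton] at hu
        rcases hu with rfl | rfl | rfl | rfl
        · exact hvS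
        · exact mem_edgesIn.1 h1.1 _ (by simp [ha])
        · exact mem_edgesIn.1 h2.1 _ (by simp [hb])
        · exact mem_edgesIn.1 h3.1 _ (by simp [hc'])
      have hdr : ∀ e ∈ edgesIn ends S, e ∈ ({e1, e2, e3} : Finset E) →
          Disjoint (D.inter e) (D.rest S {v, a, b, c} {e1, e2, e3}) := fun e he hm =>
        inter_disj_rest hAS fun f hf hfR => hdis e he f hf (by rintro rfl; exact hfR hm)
      have hjoin : ∀ e u, ends e = s(v, u) →
          JoinedIn ((D.inter e ∪ {D.pos v}) ∪ {D.pos u}) (D.pos v) (D.pos u) := by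
        intro e u he
        have j1 := D.end_joined e (u := v) (by simp [he]) (D.mid_mem e)
        have j2 := D.end_joined e (u := u) (by simp [he]) (D.mid_mem e)
        refine (j1.symm.mono subset_union_left).trans (j2.mono ?_)
        exact union_subset_union_left _ subset_union_left
      refine degree_case (D := D) (S := S) (A := {v, a, b, c}) (R := {e1, e2, e3})
        (I := (D.inter e1 ∪ D.inter e2 ∪ D.inter e3) ∪ {D.pos v}) hinj hnd hF hcl v a b c
        hva hvb hvc hab hac hbc rfl hAS e1 e2 e3 ha hb hc' rfl ?_ (by simp) ih
      refine ⟨?_, ?_, ?_, ?_⟩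
      · refine union_subset (union_subset (union_subset (D.inter_subset_image _)
          (D.inter_subset_image _)) (D.inter_subset_image _)) ?_
        rintro _ rfl
        exact D.pos_mem_image _
      · refine disjoint_union_left.2 ⟨disjoint_union_left.2 ⟨disjoint_union_left.2
          ⟨hdr _ h1.1 (by simp), hdr _ h2.1 (by simp)⟩, hdr _ h3.1 (by simp)⟩, ?_⟩
        rw [disjoint_singleton_left]
        exact D.pos_not_mem_rest _ _ _ (by simp)
      · rintro u hu (((h | h) | h) | h)
        · exact D.arc_avoid _ _ h
        · exact D.arc_avoid _ _ h
        · exact D.arc_avoid _ _ h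
        · have := D.pos_inj h
          subst this
          simp only [Finset.mem_insert, Finset.mem_singleton] at hu
          tauto
      · intro u hu
        simp only [Finset.mem_insert, Finset.mem_singleton] at hu
        rcases hu with rfl | rfl | rfl
        · refine (hjoin _ _ ha).mono (union_subset_union_left _ (union_subset_union_left _ ?_))
          exact subset_union_left.trans subset_union_left
        · refine (hjoin _ _ hb).mono (union_subset_union_left _ (union_subset_union_left _ ?_))
          exact subset_union_right.trans subset_union_left
        · refine (hjoin _ _ hc').mono (union_subset_union_left _ (union_subset_union_left _ ?_))
          exact subset_union_right

end MultiDrawing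

theorem outer_bound (V : Type) [Fintype V] (G : SimpleGraph V) (hV : 3 ≤ Fintype.card V)
    (h : OuterOnePlanar G) : 2 * G.edgeSet.ncard ≤ 5 * Fintype.card V - 8 := by
  classical
  obtain ⟨D, hone, F, hF, -, hcl⟩ := h
  have : Fintype G.edgeSet := Fintype.ofFinite _
  have := MultiDrawing.main_bound (D := D) Subtype.val_injective
    (fun e => G.not_isDiag_of_mem_edgeSet e.2) hone hF hcl _ Finset.univ rfl
    (by rw [Finset.card_univ]; omega)
  have h2 : edgesIn (fun e : G.edgeSet => (e : Sym2 V)) Finset.univ = Finset.univ := by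
    ext; simp [mem_edgesIn]
  rw [h2, Finset.card_univ, Finset.card_univ] at this
  rw [← Nat.card_coe_set_eq, Nat.card_eq_fintype_card]
  omega

/-- The ladder of crossed squares on `2 m + 4` vertices. -/
def ladder (m : ℕ) : SimpleGraph (Fin (2 * m + 4)) where
  Adj u v := u ≠ v ∧ u.val / 2 ≤ v.val / 2 + 1 ∧ v.val / 2 ≤ u.val / 2 + 1
  symm := ⟨fun _ _ h => ⟨h.1.symm, h.2.2, h.2.1⟩⟩
  loopless := ⟨fun _ h => h.1 rfl⟩

theorem ladder_pick (m : ℕ) (e : (ladder m).edgeSet) : ∃ u v : Fin (2 * m + 4),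
    (e : Sym2 (Fin (2 * m + 4))) = s(u, v) ∧ u.val < v.val ∧ v.val / 2 ≤ u.val / 2 + 1 := by
  obtain ⟨e, he⟩ := e
  induction e with
  | _ x y =>
    rw [SimpleGraph.mem_edgeSet] at he
    obtain ⟨h1, h2, h3⟩ := he
    have h1' : x.val ≠ y.val := fun h => h1 (Fin.ext h)
    rcases lt_or_gt_of_ne h1' with h | h
    · exact ⟨x, y, rfl, h, h3⟩
    · exact ⟨y, x, Sym2.eq_swap, h, h2⟩

/-- The position of the vertex number `a`. -/
def lpos (a : ℕ) : Plane := (((a / 2 : ℕ) : ℝ), ((a % 2 : ℕ) : ℝ))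

/-- The straight segment from vertex `a` to vertex `b`. -/
def lseg (a b : ℕ) (t : ℝ) : Plane :=
  ((1 - t) * ((a / 2 : ℕ) : ℝ) + t * ((b / 2 : ℕ) : ℝ),
    (1 - t) * ((a % 2 : ℕ) : ℝ) + t * ((b % 2 : ℕ) : ℝ))

theorem lpos_inj {a b : ℕ} (h : lpos a = lpos b) : a = b := by
  simp only [lpos, Prod.mk.injEq, Nat.cast_inj] at h
  omega

theorem lseg_zero (a b : ℕ) : lseg a b 0 = lpos a := by simp [lseg, lpos]

theorem lseg_one (a b : ℕ) : lseg a b 1 = lpos b := by simp [lseg, lpos]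

theorem lseg_cont (a b : ℕ) : Continuous (lseg a b) := by
  unfold lseg
  fun_prop

/-- Each edge is vertical or goes one step to the right. -/
theorem lseg_cases {a b : ℕ} (h : a < b) (h' : b / 2 ≤ a / 2 + 1) :
    (b / 2 = a / 2 ∧ a % 2 = 0 ∧ b % 2 = 1 ∧ ∀ t, lseg a b t = (((a / 2 : ℕ) : ℝ), t)) ∨
    (b / 2 = a / 2 + 1 ∧ ∀ t, lseg a b t = (((a / 2 : ℕ) : ℝ) + t,
      (1 - t) * ((a % 2 : ℕ) : ℝ) + t * ((b % 2 : ℕ) : ℝ))) := by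
  by_cases hb : b / 2 = a / 2
  · left
    have h0 : a % 2 = 0 := by omega
    have h1 : b % 2 = 1 := by omega
    refine ⟨hb, h0, h1, fun t => ?_⟩
    simp only [lseg, hb, h0, h1, Prod.mk.injEq]
    constructor
    · ring
    · push_cast; ring
  · right
    have hb' : b / 2 = a / 2 + 1 := by omega
    refine ⟨hb', fun t => ?_⟩
    simp only [lseg, hb', Prod.mk.injEq, and_true]
    push_cast; ring

theorem cast_frac {x y : ℕ} {t : ℝ} (h0 : 0 < t) (h1 : t < 1) (h : (x : ℝ) = y + t) : False := by
  have e1 : y < x := by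
    have : (y : ℝ) < x := by linarith
    exact_mod_cast this
  have e2 : x < y + 1 := by
    have : (x : ℝ) < ((y + 1 : ℕ) : ℝ) := by push_cast; linarith
    exact_mod_cast this
  omega

theorem cast_frac2 {x y : ℕ} {s t : ℝ} (h0 : 0 < t) (h1 : t < 1) (h0' : 0 < s) (h1' : s < 1)
    (h : (x : ℝ) + s = y + t) : x = y := by
  have e1 : x < y + 1 := by
    have : (x : ℝ) < ((y + 1 : ℕ) : ℝ) := by push_cast; linarith
    exact_mod_cast this
  have e2 : y < x + 1 := by
    have : (y : ℝ) < ((x + 1 : ℕ) : ℝ) := by push_cast; linarith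
    exact_mod_cast this
  omega

theorem lseg_inj {a b : ℕ} (h : a < b) (h' : b / 2 ≤ a / 2 + 1) :
    Function.Injective (lseg a b) := by
  intro s t hst
  rcases lseg_cases h h' with ⟨-, -, -, H⟩ | ⟨-, H⟩
  · rw [H, H, Prod.mk.injEq] at hst
    exact hst.2
  · rw [H, H, Prod.mk.injEq] at hst
    linarith [hst.1]

theorem lseg_avoid {a b : ℕ} (h : a < b) (h' : b / 2 ≤ a / 2 + 1) (w : ℕ) :
    lpos w ∉ lseg a b '' Ioo (0:ℝ) 1 := by
  rintro ⟨t, ⟨t0, t1⟩, ht⟩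
  rcases lseg_cases h h' with ⟨-, -, -, H⟩ | ⟨-, H⟩
  · rw [H, lpos, Prod.mk.injEq] at ht
    refine cast_frac (x := w % 2) (y := 0) t0 t1 ?_
    rw [← ht.2]; simp
  · rw [H, lpos, Prod.mk.injEq] at ht
    exact cast_frac t0 t1 ht.1.symm

/-- The only crossings are between the two diagonals of a square, at its centre. -/
theorem lseg_cross {a b c d : ℕ} (h : a < b) (h' : b / 2 ≤ a / 2 + 1) (k : c < d)
    (k' : d / 2 ≤ c / 2 + 1) (hne : ¬ (a = c ∧ b = d)) {p : Plane}
    (hp : p ∈ lseg a b '' Ioo (0:ℝ) 1) (hq : p ∈ lseg c d '' Ioo (0:ℝ) 1) :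
    a / 2 = c / 2 ∧ b / 2 = a / 2 + 1 ∧ d / 2 = c / 2 + 1 ∧ a % 2 + c % 2 = 1 ∧
      b % 2 + d % 2 = 1 ∧ a % 2 + b % 2 = 1 ∧ p = lseg a b (1 / 2) := by
  obtain ⟨s, ⟨s0, s1⟩, rfl⟩ := hp
  obtain ⟨t, ⟨t0, t1⟩, ht⟩ := hq
  rcases lseg_cases h h' with ⟨b1, b2, b3, H⟩ | ⟨b1, H⟩ <;>
    rcases lseg_cases k k' with ⟨d1, d2, d3, K⟩ | ⟨d1, K⟩
  · rw [H, K, Prod.mk.injEq, Nat.cast_inj] at ht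
    omega
  · rw [H, K, Prod.mk.injEq] at ht
    exact (cast_frac t0 t1 ht.1.symm).elim
  · rw [H, K, Prod.mk.injEq] at ht
    exact (cast_frac s0 s1 ht.1).elim
  · rw [H, K, Prod.mk.injEq] at ht
    have hx := cast_frac2 s0 s1 t0 t1 ht.1
    have hts : t = s := by
      have := ht.1
      rw [hx] at this
      linarith
    subst hts
    have hy := ht.2
    have fin : ∀ x : ℕ, x % 2 = 0 ∨ x % 2 = 1 := fun x => by omega
    have half : a % 2 + c % 2 = 1 ∧ b % 2 + d % 2 = 1 ∧ a % 2 + b % 2 = 1 ∧ t = 1 / 2 := by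
      rcases fin a with ha | ha <;> rcases fin b with hb | hb <;> rcases fin c with hc | hc <;>
        rcases fin d with hd | hd <;> rw [ha, hb, hc, hd] at hy <;> push_cast at hy <;>
        first
          | exact absurd ⟨by omega, by omega⟩ hne
          | (exfalso; linarith)
          | exact ⟨by omega, by omega, by omega, by linarith⟩
    obtain ⟨y1, y2, y3, y4⟩ := half
    exact ⟨hx.symm, b1, d1, y1, y2, y3, by rw [y4]⟩

/-- The straight-line drawing of the ladder. -/
def ladderD (m : ℕ) : (ladder m).Drawing where
  pos v := lpos v.val
  pos_inj _ _ h := Fin.ext (lpos_inj h)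
  arc e := lseg (ladder_pick m e).choose.val (ladder_pick m e).choose_spec.choose.val
  arc_cont e := (lseg_cont _ _).continuousOn
  arc_inj e := (lseg_inj (ladder_pick m e).choose_spec.choose_spec.2.1
    (ladder_pick m e).choose_spec.choose_spec.2.2).injOn
  arc_ends e := ⟨_, _, (ladder_pick m e).choose_spec.choose_spec.1, lseg_zero _ _, lseg_one _ _⟩
  arc_avoid e w := lseg_avoid (ladder_pick m e).choose_spec.choose_spec.2.1
    (ladder_pick m e).choose_spec.choose_spec.2.2 w.val
  no_incident_cross e f hef := by
    rintro ⟨p, hp, hq⟩ x ⟨hx, hx'⟩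
    have he := (ladder_pick m e).choose_spec.choose_spec
    have hf := (ladder_pick m f).choose_spec.choose_spec
    generalize (ladder_pick m e).choose_spec.choose = v at *
    generalize (ladder_pick m e).choose = u at *
    generalize (ladder_pick m f).choose_spec.choose = v' at *
    generalize (ladder_pick m f).choose = u' at *
    have hc := lseg_cross he.2.1 he.2.2 hf.2.1 hf.2.2 (by
      rintro ⟨h1, h2⟩
      apply hef
      apply Subtype.ext
      rw [he.1, hf.1, Fin.ext h1, Fin.ext h2]) hp hq
    rw [he.1, Sym2.mem_iff] at hx
    rw [hf.1, Sym2.mem_iff] at hx'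
    simp only [Fin.ext_iff] at hx hx'
    omega

theorem ladderD_pick (m : ℕ) (e : (ladder m).edgeSet) : ∃ u v : Fin (2 * m + 4),
    (e : Sym2 (Fin (2 * m + 4))) = s(u, v) ∧ u.val < v.val ∧ v.val / 2 ≤ u.val / 2 + 1 ∧
    (ladderD m).arc e = lseg u.val v.val :=
  ⟨_, _, (ladder_pick m e).choose_spec.choose_spec.1,
    (ladder_pick m e).choose_spec.choose_spec.2.1,
    (ladder_pick m e).choose_spec.choose_spec.2.2, rfl⟩

theorem ladderD_one (m : ℕ) : (ladderD m).IsOnePlanarD := by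
  rintro e ⟨f, p⟩ ⟨hf, hp1, hp2⟩ ⟨g, q⟩ ⟨hg, hq1, hq2⟩
  simp only [MultiDrawing.inter] at *
  obtain ⟨u, v, he1, he2, he3, he4⟩ := ladderD_pick m e
  obtain ⟨u', v', hf1, hf2, hf3, hf4⟩ := ladderD_pick m f
  obtain ⟨u'', v'', hg1, hg2, hg3, hg4⟩ := ladderD_pick m g
  rw [he4] at hp1 hq1
  rw [hf4] at hp2
  rw [hg4] at hq2
  have c1 := lseg_cross he2 he3 hf2 hf3 (by
    rintro ⟨h1, h2⟩
    apply hf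
    apply Subtype.ext
    rw [he1, hf1, Fin.ext h1, Fin.ext h2]) hp1 hp2
  have c2 := lseg_cross he2 he3 hg2 hg3 (by
    rintro ⟨h1, h2⟩
    apply hg
    apply Subtype.ext
    rw [he1, hg1, Fin.ext h1, Fin.ext h2]) hq1 hq2
  have hu : u' = u'' := Fin.ext (by omega)
  have hv : v' = v'' := Fin.ext (by omega)
  rw [Prod.mk.injEq]
  constructor
  · apply Subtype.ext
    rw [hf1, hg1, hu, hv]
  · rw [c1.2.2.2.2.2.2, c2.2.2.2.2.2.2]

theorem ladderD_image (m : ℕ) {p : Plane} (hp : p ∈ (ladderD m).image) :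
    0 ≤ p.1 ∧ 0 ≤ p.2 ∧ p.2 ≤ 1 := by
  have hm : ∀ a : ℕ, (0 : ℝ) ≤ ((a % 2 : ℕ) : ℝ) ∧ ((a % 2 : ℕ) : ℝ) ≤ 1 := fun a =>
    ⟨Nat.cast_nonneg _, by exact_mod_cast (by omega : a % 2 ≤ 1)⟩
  rcases hp with ⟨v, rfl⟩ | hp
  · exact ⟨Nat.cast_nonneg _, hm v.val⟩
  · obtain ⟨e, t, ⟨t0, t1⟩, rfl⟩ := mem_iUnion.1 hp
    obtain ⟨u, v, -, -, -, h⟩ := ladderD_pick m e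
    rw [h]
    have ht : 0 ≤ 1 - t := by linarith
    have hu := hm u.val
    have hv := hm v.val
    simp only [lseg]
    refine ⟨by positivity, by positivity, ?_⟩
    nlinarith [mul_le_mul_of_nonneg_left hu.2 ht, mul_le_mul_of_nonneg_left hv.2 t0]

theorem ladder_outer (m : ℕ) : OuterOnePlanar (ladder m) := by
  refine ⟨ladderD m, ladderD_one m, connectedComponentIn (ladderD m).imageᶜ (-1, -1),
    ⟨(-1, -1), fun h => ?_, rfl⟩, ?_, ?_⟩
  · have := (ladderD_image m h).1
    norm_num at this
  all_goals
    have hpc : IsPreconnected ((((univ : Set ℝ) ×ˢ Iio (0:ℝ)) ∪ (Iio (0:ℝ) ×ˢ (univ : Set ℝ))) ∪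
        ((univ : Set ℝ) ×ˢ Ioi (1:ℝ))) := by
      refine IsPreconnected.union (-1, 2) ?_ ?_ (IsPreconnected.union (-1, -1) ?_ ?_ ?_ ?_) ?_
      · right; constructor <;> norm_num
      · constructor <;> norm_num
      · constructor <;> norm_num
      · constructor <;> norm_num
      · exact (convex_univ.prod (convex_Iio _)).isPreconnected
      · exact ((convex_Iio _).prod convex_univ).isPreconnected
      · exact (convex_univ.prod (convex_Ioi _)).isPreconnected
    have hsub : (((univ : Set ℝ) ×ˢ Iio (0:ℝ)) ∪ (Iio (0:ℝ) ×ˢ (univ : Set ℝ))) ∪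
        ((univ : Set ℝ) ×ˢ Ioi (1:ℝ)) ⊆
        connectedComponentIn (ladderD m).imageᶜ ((-1, -1) : Plane) := by
      refine hpc.subset_connectedComponentIn ?_ ?_
      · left; left; constructor <;> norm_num
      · rintro p hp hp'
        obtain ⟨h1, h2, h3⟩ := ladderD_image m hp'
        rcases hp with (hp | hp) | hp
        · exact absurd hp.2 (not_lt.2 h2)
        · exact absurd hp.1 (not_lt.2 h1)
        · exact absurd hp.2 (not_lt.2 h3)
  · intro hb
    obtain ⟨r, hr⟩ := isBounded_iff_forall_norm_le.1 hb
    have h1 := hr (-(|r| + 1), 0) (hsub (Or.inl (Or.inr ⟨by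
      have := abs_nonneg r
      simp only [mem_Iio]; linarith, mem_univ _⟩)))
    have h2 := (norm_fst_le ((-(|r| + 1), 0) : ℝ × ℝ)).trans h1
    rw [Real.norm_eq_abs, abs_neg] at h2
    linarith [le_abs_self (|r| + 1), le_abs_self r]
  · intro v
    have hv : v.val % 2 = 0 ∨ v.val % 2 = 1 := by omega
    have hpos : (ladderD m).pos v = lpos v.val := rfl
    refine closure_mono hsub ?_
    rw [hpos]
    rcases hv with hv | hv
    · refine closure_mono (subset_union_left.trans subset_union_left) ?_
      rw [closure_prod_eq, closure_Iio]
      exact ⟨by simp, by simp [lpos, hv]⟩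
    · refine closure_mono subset_union_right ?_
      rw [closure_prod_eq, closure_Ioi]
      exact ⟨by simp, by simp [lpos, hv]⟩

theorem ladder_card (m : ℕ) : 5 * m + 6 ≤ (ladder m).edgeSet.ncard := by
  classical
  let f : Fin (5 * m + 6) → (ladder m).edgeSet := fun j =>
    ⟨s(⟨2 * (j.val / 5) + j.val % 5 / 3, by omega⟩,
      ⟨2 * (j.val / 5) + (if j.val % 5 ≤ 2 then j.val % 5 + 1 else j.val % 5 - 1),
        by split_ifs <;> omega⟩), by
      rw [SimpleGraph.mem_edgeSet]
      refine ⟨?_, ?_, ?_⟩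
      · rw [Ne, Fin.ext_iff]
        dsimp only
        split_ifs <;> omega
      · dsimp only
        split_ifs <;> omega
      · dsimp only
        split_ifs <;> omega⟩
  have hf : Function.Injective f := by
    intro i j hij
    have h := congrArg Subtype.val hij
    simp only [f, Sym2.eq_iff, Fin.ext_iff] at h
    apply Fin.ext
    split_ifs at h <;> omega
  have : Fintype (ladder m).edgeSet := Fintype.ofFinite _
  have h := Fintype.card_le_of_injective f hf
  rw [← Nat.card_coe_set_eq, Nat.card_eq_fintype_card]
  simpa using h

theorem tight_infinite : {n : ℕ | 3 ≤ n ∧ ∃ G : SimpleGraph (Fin n), OuterOnePlanar G ∧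
      2 * G.edgeSet.ncard = 5 * n - 8}.Infinite := by
  refine Set.infinite_of_injective_forall_mem (f := fun m : ℕ => 2 * m + 4) ?_ ?_
  · intro a b h
    dsimp only at h
    omega
  · intro m
    refine ⟨by omega, ladder m, ladder_outer m, ?_⟩
    have h1 := ladder_card m
    have h2 := outer_bound _ (ladder m) (by simp) (ladder_outer m)
    rw [Fintype.card_fin] at h2
    omega

/-- Every outer 1-planar graph on `n ≥ 3` vertices has at most
`2.5 n − 4` edges, and this bound is tight for infinitely many `n`. -/
theorem outer_one_planar_edge_bound :
    (∀ (V : Type) [Fintype V] (G : SimpleGraph V), 3 ≤ Fintype.card V →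
      OuterOnePlanar G → 2 * G.edgeSet.ncard ≤ 5 * Fintype.card V - 8) ∧
    {n : ℕ | 3 ≤ n ∧ ∃ G : SimpleGraph (Fin n), OuterOnePlanar G ∧
      2 * G.edgeSet.ncard = 5 * n - 8}.Infinite := by
  exact ⟨outer_bound, tight_infinite⟩
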